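/- arXiv:0807.4133 — 6 statements merged into one kernel-verified Lean document; each statement's English description precedes it below -/
import Mathlib

section
/- Let n ∈ ℕ, n ≥ 1, and let f : [a,b] → ℝ be n-convex. Then f is continuous at every point of the open interval (a,b) and f is bounded on [a,b]. -/
/-- `f` is `n`-convex on `s ⊆ ℝ`: every divided difference
`[x₁,…,x_{n+2}; f] = ∑ i, f(xᵢ)/∏_{j≠i}(xᵢ-xⱼ)` of `f` at `n+2` pairwise
distinct points of `s` is nonnegative. -/
def NConvexOn (n : ℕ) (s : Set ℝ) (f : ℝ → ℝ) : Prop :=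
  ∀ x : Fin (n + 2) → ℝ, Function.Injective x → (∀ i, x i ∈ s) →
    0 ≤ ∑ i, f (x i) / ∏ j ∈ Finset.univ.erase i, (x i - x j)

/-- Divided differences of an `n`-convex function, indexed by a finset of nodes. -/
theorem NConvexOn.sum_div_prod_nonneg {n : ℕ} {s : Set ℝ} {f : ℝ → ℝ} (hf : NConvexOn n s f)
    {P : Finset ℝ} (hP : P.card = n + 2) (hPs : ∀ p ∈ P, p ∈ s) :
    0 ≤ ∑ p ∈ P, f p / ∏ q ∈ P.erase p, (p - q) := by
  let e := P.orderEmbOfFin hP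
  have hmap : Finset.univ.map e.toEmbedding = P := by
    simp [e]
  have h := hf e e.injective fun i => hPs _ (P.orderEmbOfFin_mem hP i)
  rw [← hmap, Finset.sum_map]
  refine h.trans_eq (Finset.sum_congr rfl fun i _ => ?_)
  rw [← Finset.map_erase, Finset.prod_map]
  rfl

/-- The error of Lagrange interpolation of an `n`-convex function at `n + 1` nodes has the sign of
the nodal polynomial. -/
theorem NConvexOn.sub_interpolate_mul_nodal_nonneg {n : ℕ} {s : Set ℝ} {f : ℝ → ℝ}
    (hf : NConvexOn n s f) {P : Finset ℝ} (hP : P.card = n + 1) (hPs : ∀ p ∈ P, p ∈ s)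
    {x : ℝ} (hx : x ∈ s) :
    0 ≤ (f x - (Lagrange.interpolate P id f).eval x) * (Lagrange.nodal P id).eval x := by
  by_cases hxP : x ∈ P
  · have : (Lagrange.nodal P id).eval x = 0 := Lagrange.eval_nodal_at_node (v := id) hxP
    simp [this]
  have hne : ∀ p ∈ P, x ≠ p := fun p hp h => hxP (h ▸ hp)
  have hN : (Lagrange.nodal P id).eval x ≠ 0 := Lagrange.eval_nodal_not_at_node hne
  have hdd := hf.sum_div_prod_nonneg (P := insert x P)
    (by rw [Finset.card_insert_of_notMem hxP, hP]) (by simpa using ⟨hx, hPs⟩)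
  rw [Finset.sum_insert hxP, Finset.erase_insert hxP] at hdd
  have hsum : ∑ p ∈ P, f p / ∏ q ∈ (insert x P).erase p, (p - q) =
      -∑ p ∈ P, Lagrange.nodalWeight P id p * (x - id p)⁻¹ * f p := by
    rw [← Finset.sum_neg_distrib]
    refine Finset.sum_congr rfl fun p hp => ?_
    rw [Finset.erase_insert_of_ne (hne p hp), Finset.prod_insert (by simp [hxP]),
      Lagrange.nodalWeight, Finset.prod_inv_distrib, ← neg_sub x p]
    simp only [id, div_eq_mul_inv, mul_inv, inv_neg]
    ring
  have hprod : ∏ q ∈ P, (x - q) = (Lagrange.nodal P id).eval x := by simp [Lagrange.eval_nodal]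
  rw [hsum, hprod] at hdd
  rw [Lagrange.eval_interpolate_not_at_node (v := id) f hne]
  have := mul_nonneg hdd (sq_nonneg ((Lagrange.nodal P id).eval x))
  refine this.trans_eq ?_
  field_simp
  ring

/-- If `y` lies between `p` and `q`, its distance to `m` is controlled by those of `p` and `q`. -/
theorem abs_sub_le_of_sub_mul_sub_nonpos {y p q : ℝ} (h : (y - p) * (y - q) ≤ 0) (m : ℝ) :
    |y - m| ≤ |p - m| + |q - m| := by
  have := neg_abs_le (p - m)
  have := neg_abs_le (q - m)
  have := le_abs_self (p - m)
  have := le_abs_self (q - m)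
  have := abs_nonneg (p - m)
  have := abs_nonneg (q - m)
  rw [abs_le]
  rcases mul_nonpos_iff.1 h with h | h <;> constructor <;> linarith [h.1, h.2]

/-- An `n`-convex function on `[a, b]` lies between its interpolation polynomials at `T ∪ {a}` and
at `T ∪ {b}`, for every set `T` of `n` points of `(a, b)`. -/
theorem NConvexOn.sub_interpolate_mul_sub_interpolate_nonpos {n : ℕ} {a b : ℝ} {f : ℝ → ℝ}
    (hf : NConvexOn n (Set.Icc a b) f) {T : Finset ℝ} (hT : T.card = n)
    (hTs : ∀ t ∈ T, t ∈ Set.Ioo a b) {x : ℝ} (hx : x ∈ Set.Icc a b) :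
    (f x - (Lagrange.interpolate (insert a T) id f).eval x) *
      (f x - (Lagrange.interpolate (insert b T) id f).eval x) ≤ 0 := by
  have haT : a ∉ T := fun h => (hTs a h).1.false
  have hbT : b ∉ T := fun h => (hTs b h).2.false
  have hab : a ≤ b := hx.1.trans hx.2
  have hTI : ∀ t ∈ T, t ∈ Set.Icc a b := fun t ht => Set.Ioo_subset_Icc_self (hTs t ht)
  have node {P : Finset ℝ} (hxP : x ∈ P) : (Lagrange.interpolate P id f).eval x = f x :=
    Lagrange.eval_interpolate_at_node (v := id) f Function.injective_id.injOn hxP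
  by_cases hxa : x ∈ insert a T
  · rw [node hxa, sub_self, zero_mul]
  by_cases hxb : x ∈ insert b T
  · rw [node hxb, sub_self, mul_zero]
  have hA := hf.sub_interpolate_mul_nodal_nonneg (P := insert a T)
    (by rw [Finset.card_insert_of_notMem haT, hT])
    (by simpa [hab] using hTI) hx
  have hB := hf.sub_interpolate_mul_nodal_nonneg (P := insert b T)
    (by rw [Finset.card_insert_of_notMem hbT, hT])
    (by simpa [hab] using hTI) hx
  rw [Finset.mem_insert, not_or] at hxa hxb
  have hax : 0 < x - a := sub_pos.2 (lt_of_le_of_ne hx.1 (Ne.symm hxa.1))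
  have hbx : 0 < b - x := sub_pos.2 (lt_of_le_of_ne hx.2 hxb.1)
  have hN : (Lagrange.nodal T id).eval x ≠ 0 :=
    Lagrange.eval_nodal_not_at_node fun t ht h => hxa.2 (h ▸ ht)
  rw [Lagrange.nodal_insert_eq_nodal haT, Polynomial.eval_mul] at hA
  rw [Lagrange.nodal_insert_eq_nodal hbT, Polynomial.eval_mul] at hB
  simp only [id, Polynomial.eval_sub, Polynomial.eval_X, Polynomial.eval_C] at hA hB
  have hpos : 0 < (x - a) * (b - x) * (Lagrange.nodal T id).eval x ^ 2 := by positivity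
  refine nonpos_of_mul_nonpos_left ?_ hpos
  linarith [mul_nonneg hA hB]

/-- An `n`-convex function on `[a,b]` is continuous at every point of `(a,b)`
and bounded on `[a,b]`. -/
theorem nconvex_continuousOn_Ioo_and_bddOn_Icc
    (n : ℕ) (hn : 1 ≤ n) (a b : ℝ) (hab : a < b) (f : ℝ → ℝ)
    (hf : NConvexOn n (Set.Icc a b) f) :
    ContinuousOn f (Set.Ioo a b) ∧ ∃ M : ℝ, ∀ x ∈ Set.Icc a b, |f x| ≤ M := by
  constructor
  · intro c hc
    obtain ⟨S, hS, hScard⟩ :=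
      ((Set.Ioo_infinite hab).sdiff (Set.finite_singleton c)).exists_subset_card_eq (n - 1)
    have hcS : c ∉ S := fun h => (hS h).2 rfl
    have hT : (insert c S).card = n := by rw [Finset.card_insert_of_notMem hcS]; omega
    have hTs : ∀ t ∈ insert c S, t ∈ Set.Ioo a b := by
      simpa [hc.1, hc.2] using fun t ht => (hS ht).1
    have tendsto (u : ℝ) : Filter.Tendsto
        (fun x => |(Lagrange.interpolate (insert u (insert c S)) id f).eval x - f c|)
        (nhdsWithin c (Set.Ioo a b)) (nhds 0) := by
      have hnode : (Lagrange.interpolate (insert u (insert c S)) id f).eval c = f c :=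
        Lagrange.eval_interpolate_at_node (v := id) f Function.injective_id.injOn (by simp)
      have hcont : Continuous
          fun x => |(Lagrange.interpolate (insert u (insert c S)) id f).eval x - f c| := by
        fun_prop
      have hlim := (hcont.tendsto c).mono_left (nhdsWithin_le_nhds (s := Set.Ioo a b))
      rwa [hnode, sub_self, abs_zero] at hlim
    refine tendsto_iff_dist_tendsto_zero.2 ?_
    refine squeeze_zero' (.of_forall fun _ => dist_nonneg) ?_
      (by simpa using (tendsto a).add (tendsto b))
    filter_upwards [self_mem_nhdsWithin] with x hx
    exact abs_sub_le_of_sub_mul_sub_nonpos (hf.sub_interpolate_mul_sub_interpolate_nonpos hT hTs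
      (Set.Ioo_subset_Icc_self hx)) _
  · obtain ⟨T, hTs, hT⟩ := (Set.Ioo_infinite hab).exists_subset_card_eq n
    have hcont : Continuous fun x => |(Lagrange.interpolate (insert a T) id f).eval x - 0| +
        |(Lagrange.interpolate (insert b T) id f).eval x - 0| := by fun_prop
    obtain ⟨M, hM⟩ := isCompact_Icc.bddAbove_image (hcont.continuousOn (s := Set.Icc a b))
    refine ⟨M, fun x hx => ?_⟩
    have hle := abs_sub_le_of_sub_mul_sub_nonpos
      (hf.sub_interpolate_mul_sub_interpolate_nonpos hT (fun t ht => hTs ht) hx) 0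
    rw [sub_zero] at hle
    exact hle.trans (hM (Set.mem_image_of_mem _ hx))
end

section
/- Let I ⊆ ℝ be a nonempty open interval, n ∈ ℕ, n ≥ 1, and f : I → ℝ. Then f is n-convex on I if and only if f is (n−1)-times differentiable on I and its (n−1)-st derivative f^{(n−1)} is convex on I. -/
/-- The divided difference of `f` over a finite set of nodes. -/
noncomputable def dividedDiff (s : Finset ℝ) (f : ℝ → ℝ) : ℝ :=
  ∑ x ∈ s, f x / ∏ y ∈ s.erase x, (x - y)

theorem dividedDiff_congr {s : Finset ℝ} {f g : ℝ → ℝ} (h : ∀ x ∈ s, f x = g x) :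
    dividedDiff s f = dividedDiff s g :=
  Finset.sum_congr rfl fun x hx => by rw [h x hx]

theorem dividedDiff_sub_const_mul (s : Finset ℝ) (f g : ℝ → ℝ) (c : ℝ) :
    dividedDiff s (fun x => f x - c * g x) = dividedDiff s f - c * dividedDiff s g := by
  simp only [dividedDiff, Finset.mul_sum, ← Finset.sum_sub_distrib]
  exact Finset.sum_congr rfl fun x _ => by ring

theorem dividedDiff_neg (s : Finset ℝ) (f : ℝ → ℝ) :
    dividedDiff s (fun x => -f x) = -dividedDiff s f := by
  simp only [dividedDiff, ← Finset.sum_neg_distrib, neg_div]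

theorem dividedDiff_polynomial {s : Finset ℝ} {P : Polynomial ℝ} (hP : P.degree < s.card) :
    dividedDiff s (fun x => P.eval x) = P.coeff (s.card - 1) :=
  (Lagrange.coeff_eq_sum (v := id) Function.injective_id.injOn hP).symm

theorem dividedDiff_pow {s : Finset ℝ} {m : ℕ} (hs : s.card = m + 1) :
    dividedDiff s (fun x => x ^ m) = 1 := by
  have h := dividedDiff_polynomial (s := s) (P := Polynomial.X ^ m) (by
    rw [Polynomial.degree_X_pow, hs]; exact_mod_cast Nat.lt_succ_self m)
  simpa [hs] using h

theorem dividedDiff_image {ι : Type*} [DecidableEq ι] (t : Finset ι) (x : ι → ℝ)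
    (hx : Set.InjOn x t) (f : ℝ → ℝ) :
    dividedDiff (t.image x) f = ∑ i ∈ t, f (x i) / ∏ j ∈ t.erase i, (x i - x j) := by
  rw [dividedDiff, Finset.sum_image hx]
  refine Finset.sum_congr rfl fun i hi => ?_
  have h : (t.image x).erase (x i) = (t.erase i).image x := by
    ext z
    simp only [Finset.mem_erase, Finset.mem_image]
    constructor
    · rintro ⟨hz, j, hj, rfl⟩
      exact ⟨j, ⟨fun h => hz (h ▸ rfl), hj⟩, rfl⟩
    · rintro ⟨j, ⟨hji, hj⟩, rfl⟩
      exact ⟨fun h => hji (hx hj hi h), j, hj, rfl⟩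
  rw [h, Finset.prod_image (hx.mono (Finset.coe_subset.2 (Finset.erase_subset i t)))]

theorem sub_mul_dividedDiff_insert_insert {s : Finset ℝ} {a b : ℝ} (ha : a ∉ s) (hb : b ∉ s)
    (hab : a ≠ b) (f : ℝ → ℝ) :
    (b - a) * dividedDiff (insert a (insert b s)) f =
      dividedDiff (insert b s) f - dividedDiff (insert a s) f := by
  have hab' : a ∉ insert b s := by simp [hab, ha]
  have e1 : ∀ x ∈ s, (insert a (insert b s)).erase x = insert a (insert b (s.erase x)) := by
    intro x hx
    rw [Finset.erase_insert_of_ne (by rintro rfl; exact ha hx),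
      Finset.erase_insert_of_ne (by rintro rfl; exact hb hx)]
  have e2 : ∀ c ∉ s, ∀ x ∈ s, (insert c s).erase x = insert c (s.erase x) := by
    intro c hc x hx
    rw [Finset.erase_insert_of_ne (by rintro rfl; exact hc hx)]
  have e3 : (insert a (insert b s)).erase b = insert a s := by
    rw [Finset.erase_insert_of_ne hab, Finset.erase_insert hb]
  have hba : b - a ≠ 0 := sub_ne_zero.2 hab.symm
  have hab0 : a - b ≠ 0 := sub_ne_zero.2 hab
  have key : ∀ x ∈ s, (b - a) * (f x / ∏ y ∈ (insert a (insert b s)).erase x, (x - y)) =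
      f x / ∏ y ∈ (insert b s).erase x, (x - y) - f x / ∏ y ∈ (insert a s).erase x, (x - y) := by
    intro x hx
    have hxa : x - a ≠ 0 := sub_ne_zero.2 (by rintro rfl; exact ha hx)
    have hxb : x - b ≠ 0 := sub_ne_zero.2 (by rintro rfl; exact hb hx)
    have hp : ∏ y ∈ s.erase x, (x - y) ≠ 0 := Finset.prod_ne_zero_iff.2 fun y hy =>
      sub_ne_zero.2 (Finset.ne_of_mem_erase hy).symm
    rw [e1 x hx, e2 a ha x hx, e2 b hb x hx, Finset.prod_insert (by simp [hab, ha]),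
      Finset.prod_insert (by simp [hb]), Finset.prod_insert (by simp [ha])]
    field_simp
    ring
  have hpa : ∏ y ∈ s, (a - y) ≠ 0 := Finset.prod_ne_zero_iff.2 fun y hy =>
    sub_ne_zero.2 (by rintro rfl; exact ha hy)
  have hpb : ∏ y ∈ s, (b - y) ≠ 0 := Finset.prod_ne_zero_iff.2 fun y hy =>
    sub_ne_zero.2 (by rintro rfl; exact hb hy)
  simp only [dividedDiff]
  rw [Finset.sum_insert hab', Finset.sum_insert hb, Finset.sum_insert hb, Finset.sum_insert ha,
    Finset.erase_insert hab', Finset.erase_insert ha, Finset.erase_insert hb, e3,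
    Finset.prod_insert hb, Finset.prod_insert ha, mul_add, mul_add, Finset.mul_sum,
    Finset.sum_congr rfl key, Finset.sum_sub_distrib]
  have h1 : (b - a) * (f a / ((a - b) * ∏ y ∈ s, (a - y))) = -(f a / ∏ y ∈ s, (a - y)) := by
    field_simp
    ring
  have h2 : (b - a) * (f b / ((b - a) * ∏ y ∈ s, (b - y))) = f b / ∏ y ∈ s, (b - y) := by
    field_simp
  rw [h1, h2]
  ring

theorem nConvexOn_iff_dividedDiff {n : ℕ} {I : Set ℝ} {f : ℝ → ℝ} :
    NConvexOn n I f ↔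
      ∀ s : Finset ℝ, s.card = n + 2 → (s : Set ℝ) ⊆ I → 0 ≤ dividedDiff s f := by
  constructor
  · intro h s hs hsI
    have h' := h (s.orderEmbOfFin hs) (s.orderEmbOfFin hs).injective
      fun i => hsI (s.orderEmbOfFin_mem hs i)
    rwa [← dividedDiff_image _ _ (s.orderEmbOfFin hs).injective.injOn,
      Finset.image_orderEmbOfFin_univ] at h'
  · intro h x hx hxI
    rw [← dividedDiff_image _ _ hx.injOn]
    refine h _ (by rw [Finset.card_image_of_injective _ hx]; simp) ?_
    rintro z hz
    obtain ⟨i, -, rfl⟩ := Finset.mem_image.1 (Finset.mem_coe.1 hz)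
    exact hxI i

theorem dividedDiff_triple {a b c : ℝ} (hab : a < b) (hbc : b < c) (f : ℝ → ℝ) :
    (c - a) * dividedDiff {a, b, c} f = (f c - f b) / (c - b) - (f b - f a) / (b - a) := by
  have h := sub_mul_dividedDiff_insert_insert (s := {b}) (a := a) (b := c)
    (by simp [hab.ne]) (by simp [hbc.ne']) (hab.trans hbc).ne f
  have e : ({a, b, c} : Finset ℝ) = insert a (insert c {b}) := by
    rw [Finset.pair_comm b c]
  have pair : ∀ x y : ℝ, x ≠ y → dividedDiff {x, y} f = (f x - f y) / (x - y) := by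
    intro x y hxy
    have h1 : ({x, y} : Finset ℝ).erase y = {x} := by
      rw [Finset.erase_insert_of_ne hxy]; simp
    have h2 : x - y ≠ 0 := sub_ne_zero.2 hxy
    have h3 : y - x ≠ 0 := sub_ne_zero.2 hxy.symm
    rw [dividedDiff, Finset.sum_pair hxy, Finset.erase_insert (by simpa using hxy), h1,
      Finset.prod_singleton, Finset.prod_singleton]
    field_simp
    ring
  rw [e, h, pair _ _ hbc.ne', pair _ _ hab.ne, ← neg_sub (f b) (f a), ← neg_sub b a, neg_div_neg_eq]

theorem nConvexOn_one_iff_convexOn {I : Set ℝ} (hI : Convex ℝ I) {f : ℝ → ℝ} :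
    NConvexOn 1 I f ↔ ConvexOn ℝ I f := by
  rw [nConvexOn_iff_dividedDiff]
  constructor
  · refine fun h => convexOn_of_slope_mono_adjacent hI fun {x y z} hx hz hxy hyz => ?_
    have hy : y ∈ I := hI.ordConnected.out hx hz ⟨hxy.le, hyz.le⟩
    have hd := h {x, y, z} (Finset.card_eq_three.2
      ⟨x, y, z, hxy.ne, (hxy.trans hyz).ne, hyz.ne, rfl⟩)
      (by simp [Set.insert_subset_iff, hx, hy, hz])
    have := mul_nonneg (sub_nonneg.2 (hxy.trans hyz).le) hd
    rw [dividedDiff_triple hxy hyz] at this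
    exact sub_nonneg.1 this
  · intro h s hs hsI
    set e := s.orderEmbOfFin hs
    have h01 : e 0 < e 1 := e.strictMono (by decide)
    have h12 : e 1 < e 2 := e.strictMono (by decide)
    have he : s = {e 0, e 1, e 2} := by
      ext z
      rw [← Finset.mem_coe, ← Finset.range_orderEmbOfFin s hs, Set.mem_range, Fin.exists_fin_succ,
        Fin.exists_fin_two]
      simp [e, eq_comm]
    have := h.slope_mono_adjacent (hsI (s.orderEmbOfFin_mem hs 0))
      (hsI (s.orderEmbOfFin_mem hs 2)) h01 h12
    rw [he]
    refine nonneg_of_mul_nonneg_right ?_ (sub_pos.2 (h01.trans h12))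
    rw [dividedDiff_triple h01 h12]
    exact sub_nonneg.2 this

namespace NConvexOn

variable {n : ℕ} {I : Set ℝ} {f : ℝ → ℝ}

theorem dividedDiff_union_le (hf : NConvexOn n I f) (φ : ℝ → ℝ) (T : Finset ℝ) :
    ∀ C : Finset ℝ, (T : Set ℝ) ⊆ I → (∀ x ∈ T, φ x ∈ I) → (C : Set ℝ) ⊆ I →
      Set.InjOn φ T → (∀ x ∈ T, x < φ x) → (∀ x ∈ T, φ x ∉ T) → (∀ x ∈ T, x ∉ C) →
      (∀ x ∈ T, φ x ∉ C) → T.card + C.card = n + 1 →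
      dividedDiff (T ∪ C) f ≤ dividedDiff (T.image φ ∪ C) f := by
  induction T using Finset.induction_on with
  | empty => intros; simp
  | insert a T ha ih =>
    intro C hT hφ hC hinj hlt hφT hTC hφC hcard
    have hfa := hlt a (Finset.mem_insert_self a T)
    have haD : a ∉ T ∪ C := by
      simpa [ha] using hTC a (Finset.mem_insert_self a T)
    have hφaT : φ a ∉ T := fun h => hφT a (Finset.mem_insert_self a T) (Finset.mem_insert_of_mem h)
    have hφaC : φ a ∉ C := hφC a (Finset.mem_insert_self a T)
    have hφD : φ a ∉ T ∪ C := by simp [hφaT, hφaC]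
    have hdisj : Disjoint T C := Finset.disjoint_left.2 fun x hx =>
      hTC x (Finset.mem_insert_of_mem hx)
    rw [Finset.card_insert_of_notMem ha] at hcard
    rw [Finset.coe_insert, Set.insert_subset_iff] at hT
    have hstep : dividedDiff (insert a (T ∪ C)) f ≤ dividedDiff (insert (φ a) (T ∪ C)) f := by
      rw [← sub_nonneg, ← sub_mul_dividedDiff_insert_insert haD hφD hfa.ne]
      refine mul_nonneg (sub_nonneg.2 hfa.le) (nConvexOn_iff_dividedDiff.1 hf _ ?_ ?_)
      · rw [Finset.card_insert_of_notMem (by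
          rw [Finset.mem_insert, not_or]; exact ⟨hfa.ne, haD⟩),
          Finset.card_insert_of_notMem hφD, Finset.card_union_of_disjoint hdisj]
        omega
      · simp only [Finset.coe_insert, Finset.coe_union, Set.insert_subset_iff, Set.union_subset_iff]
        exact ⟨hT.1, hφ a (Finset.mem_insert_self a T), hT.2, hC⟩
    have hrec := ih (insert (φ a) C) hT.2 (fun x hx => hφ x (Finset.mem_insert_of_mem hx))
      (by
        rw [Finset.coe_insert, Set.insert_subset_iff]
        exact ⟨hφ a (Finset.mem_insert_self a T), hC⟩)
      (hinj.mono (by simp))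
      (fun x hx => hlt x (Finset.mem_insert_of_mem hx))
      (fun x hx h => hφT x (Finset.mem_insert_of_mem hx) (Finset.mem_insert_of_mem h))
      (fun x hx => by
        rw [Finset.mem_insert, not_or]
        exact ⟨by rintro rfl; exact hφaT hx, hTC x (Finset.mem_insert_of_mem hx)⟩)
      (fun x hx => by
        rw [Finset.mem_insert, not_or]
        refine ⟨fun h => ha ?_, hφC x (Finset.mem_insert_of_mem hx)⟩
        rwa [← hinj (by simp [hx]) (by simp) h])
      (by rw [Finset.card_insert_of_notMem hφaC]; omega)
    rw [Finset.insert_union, Finset.image_insert, Finset.insert_union]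
    rw [Finset.union_insert, Finset.union_insert] at hrec
    exact hstep.trans hrec

theorem dividedDiff_le_image (hf : NConvexOn n I f) (φ : ℝ → ℝ) {s : Finset ℝ}
    (hs : s.card = n + 1) (hsI : (s : Set ℝ) ⊆ I) (hφ : ∀ x ∈ s, φ x ∈ I) (hinj : Set.InjOn φ s)
    (hlt : ∀ x ∈ s, x < φ x) (hφs : ∀ x ∈ s, φ x ∉ s) :
    dividedDiff s f ≤ dividedDiff (s.image φ) f := by
  simpa using hf.dividedDiff_union_le φ s ∅ hsI hφ (by simp) hinj hlt hφs (by simp) (by simp)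
    (by simpa using hs)

theorem dividedDiff_le_of_lt (hf : NConvexOn n I f) {s t : Finset ℝ} (hs : s.card = n + 1)
    (ht : t.card = n + 1) (hsI : (s : Set ℝ) ⊆ I) (htI : (t : Set ℝ) ⊆ I)
    (hlt : ∀ x ∈ s, ∀ y ∈ t, x < y) : dividedDiff s f ≤ dividedDiff t f := by
  let e : s ≃ t := Finset.equivOfCardEq (hs.trans ht.symm)
  let φ : ℝ → ℝ := fun x => if h : x ∈ s then e ⟨x, h⟩ else 0
  have hφ : ∀ x (h : x ∈ s), φ x = e ⟨x, h⟩ := fun x h => dif_pos h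
  have hmem : ∀ x ∈ s, φ x ∈ t := fun x h => by rw [hφ x h]; exact (e ⟨x, h⟩).2
  have hinj : Set.InjOn φ s := fun x hx y hy hxy => by
    rw [hφ x hx, hφ y hy] at hxy
    simpa using e.injective (Subtype.ext hxy)
  have himg : s.image φ = t := Finset.eq_of_subset_of_card_le
    (Finset.image_subset_iff.2 hmem) (by rw [Finset.card_image_of_injOn hinj, hs, ht])
  rw [← himg]
  exact hf.dividedDiff_le_image φ hs hsI (fun x hx => htI (hmem x hx)) hinj
    (fun x hx => hlt x hx _ (hmem x hx))
    fun x hx h => lt_irrefl _ (hlt _ h _ (hmem x hx))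

theorem exists_local_bounds (hf : NConvexOn n I f) (hI : IsOpen I) {y : ℝ} (hy : y ∈ I) :
    ∃ u v c C : ℝ, y ∈ Set.Ioo u v ∧ Set.Ioo u v ⊆ I ∧
      ∀ s : Finset ℝ, s.card = n + 1 → (s : Set ℝ) ⊆ Set.Ioo u v →
        c ≤ dividedDiff s f ∧ dividedDiff s f ≤ C := by
  obtain ⟨ε, hε, hεI⟩ := Metric.isOpen_iff.1 hI y hy
  rw [Real.ball_eq_Ioo] at hεI
  obtain ⟨A, hA, hAc⟩ := (Set.Ioo_infinite
    (show y - ε < y - ε / 2 by linarith)).exists_subset_card_eq (n + 1)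
  obtain ⟨B, hB, hBc⟩ := (Set.Ioo_infinite
    (show y + ε / 2 < y + ε by linarith)).exists_subset_card_eq (n + 1)
  have hsub : Set.Ioo (y - ε / 2) (y + ε / 2) ⊆ I :=
    (Set.Ioo_subset_Ioo (by linarith) (by linarith)).trans hεI
  refine ⟨y - ε / 2, y + ε / 2, dividedDiff A f, dividedDiff B f,
    ⟨by linarith, by linarith⟩, hsub, fun s hs hsJ => ⟨?_, ?_⟩⟩
  · exact hf.dividedDiff_le_of_lt hAc hs
      ((hA.trans (Set.Ioo_subset_Ioo le_rfl (by linarith))).trans hεI) (hsJ.trans hsub)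
      fun x hx z hz => (hA hx).2.trans (hsJ hz).1
  · exact hf.dividedDiff_le_of_lt hs hBc (hsJ.trans hsub)
      ((hB.trans (Set.Ioo_subset_Ioo (by linarith) le_rfl)).trans hεI)
      fun x hx z hz => (hsJ hx).2.trans (hB hz).1

end NConvexOn

theorem ConvexOn.differentiableAt_of_convexOn_mul_sub {J : Set ℝ} {f g : ℝ → ℝ} {y : ℝ}
    (hf : ConvexOn ℝ J f) (hg : ConvexOn ℝ J (fun x => g x - f x)) (hy : y ∈ interior J)
    (hgd : DifferentiableAt ℝ g y) : DifferentiableAt ℝ f y := by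
  have hfr := hf.hasDerivWithinAt_rightDeriv_of_mem_interior hy
  have hfl := hf.hasDerivWithinAt_leftDeriv_of_mem_interior hy
  have hgr := hgd.hasDerivAt.hasDerivWithinAt.sub hfr
  have hgl := hgd.hasDerivAt.hasDerivWithinAt.sub hfl
  have h1 := hf.leftDeriv_le_rightDeriv_of_mem_interior hy
  have h2 := hg.leftDeriv_le_rightDeriv_of_mem_interior hy
  have er : derivWithin (fun x => g x - f x) (Set.Ioi y) y = _ :=
    hgr.derivWithin (uniqueDiffWithinAt_Ioi y)
  have el : derivWithin (fun x => g x - f x) (Set.Iio y) y = _ :=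
    hgl.derivWithin (uniqueDiffWithinAt_Iio y)
  rw [er, el] at h2
  have heq : derivWithin f (Set.Iio y) y = derivWithin f (Set.Ioi y) y := by linarith
  rw [heq] at hfl
  have := hfl.Iic_of_Iio.union hfr.Ici_of_Ioi
  rw [Set.Iic_union_Ici, hasDerivWithinAt_univ] at this
  exact this.differentiableAt

namespace NConvexOn

variable {n : ℕ} {I : Set ℝ} {f : ℝ → ℝ}

theorem differentiableAt (hI : IsOpen I) (hf : NConvexOn (n + 2) I f) :
    ∀ y ∈ I, DifferentiableAt ℝ f y := by
  induction n generalizing I f with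
  | zero =>
    intro y hy
    obtain ⟨u, v, c, C, hyJ, -, hb⟩ := hf.exists_local_bounds hI hy
    have hJ : Convex ℝ (Set.Ioo u v) := convex_Ioo u v
    have h1 : ConvexOn ℝ (Set.Ioo u v) (fun x => f x - c * x ^ 2) := by
      rw [← nConvexOn_one_iff_convexOn hJ, nConvexOn_iff_dividedDiff]
      intro s hs hsJ
      rw [dividedDiff_sub_const_mul, dividedDiff_pow hs, mul_one]
      exact sub_nonneg.2 (hb s hs hsJ).1
    have h2 : ConvexOn ℝ (Set.Ioo u v) (fun x => (C - c) * x ^ 2 - (f x - c * x ^ 2)) := by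
      have e : (fun x => (C - c) * x ^ 2 - (f x - c * x ^ 2)) = fun x => -(f x - C * x ^ 2) := by
        funext x; ring
      rw [e, ← nConvexOn_one_iff_convexOn hJ, nConvexOn_iff_dividedDiff]
      intro s hs hsJ
      rw [dividedDiff_neg, dividedDiff_sub_const_mul, dividedDiff_pow hs, mul_one, neg_sub]
      exact sub_nonneg.2 (hb s hs hsJ).2
    have h3 := h1.differentiableAt_of_convexOn_mul_sub h2 (by rwa [interior_Ioo]) (by fun_prop)
    simpa using h3.fun_add (show DifferentiableAt ℝ (fun x => c * x ^ 2) y by fun_prop)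
  | succ n ih =>
    intro y hy
    obtain ⟨u, v, c, C, hyJ, -, hb⟩ := hf.exists_local_bounds hI hy
    have h1 : NConvexOn (n + 2) (Set.Ioo u v) (fun x => f x - c * x ^ (n + 3)) := by
      rw [nConvexOn_iff_dividedDiff]
      intro s hs hsJ
      rw [dividedDiff_sub_const_mul, dividedDiff_pow hs, mul_one]
      exact sub_nonneg.2 (hb s hs hsJ).1
    have h3 := ih isOpen_Ioo h1 y hyJ
    simpa using h3.fun_add (show DifferentiableAt ℝ (fun x => c * x ^ (n + 3)) y by fun_prop)

theorem of_hasDerivAt {f' : ℝ → ℝ} (hI : IsOpen I) (hf : NConvexOn (n + 1) I f)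
    (hf' : ∀ x ∈ I, HasDerivAt f (f' x) x) : NConvexOn n I f' := by
  rw [nConvexOn_iff_dividedDiff]
  intro s hs hsI
  let F : ℝ → ℝ := fun h => ∑ x ∈ s, f (x + h) / ∏ y ∈ s.erase x, (x - y)
  have hF : HasDerivAt F (dividedDiff s f') 0 := by
    refine HasDerivAt.fun_sum fun x hx => HasDerivAt.div_const ?_ _
    have := hf' x (hsI hx)
    rw [← add_zero x] at this
    simpa using this.comp_const_add x 0
  have hFh : ∀ h, F h = dividedDiff (s.image (· + h)) f := fun h => by
    rw [dividedDiff_image _ _ (add_left_injective h).injOn]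
    simp [F]
  have hF0 : F 0 = dividedDiff s f := by simp [F, dividedDiff]
  have hcont : ∀ x : ℝ, Filter.Tendsto (fun h => x + h) (nhdsWithin 0 (Set.Ioi 0)) (nhds x) :=
    fun x => by
      have : Filter.Tendsto (fun h => x + h) (nhds 0) (nhds (x + 0)) :=
        (continuous_const.add continuous_id).tendsto 0
      rw [add_zero] at this
      exact this.mono_left nhdsWithin_le_nhds
  have hev1 : ∀ᶠ h in nhdsWithin (0 : ℝ) (Set.Ioi 0), ∀ x ∈ s, x + h ∈ I :=
    (Filter.eventually_all_finset s).2 fun x hx => (hcont x).eventually (hI.mem_nhds (hsI hx))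
  have hev2 : ∀ᶠ h in nhdsWithin (0 : ℝ) (Set.Ioi 0), ∀ x ∈ s, ∀ y ∈ s, x + h ≠ y := by
    refine (Filter.eventually_all_finset s).2 fun x _ =>
      (Filter.eventually_all_finset s).2 fun y _ => ?_
    by_cases hxy : x = y
    · filter_upwards [self_mem_nhdsWithin] with h hh
      subst hxy
      simpa using (ne_of_gt hh : h ≠ 0)
    · exact (hcont x).eventually_ne hxy
  have hslope := (hasDerivWithinAt_iff_tendsto_slope' (by simp)).1
    (hF.hasDerivWithinAt (s := Set.Ioi 0))
  refine ge_of_tendsto hslope ?_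
  filter_upwards [hev1, hev2, self_mem_nhdsWithin] with h h1 h2 h3
  have h3 : 0 < h := h3
  rw [slope_def_field, sub_zero]
  refine div_nonneg (sub_nonneg.2 ?_) h3.le
  rw [hF0, hFh]
  exact hf.dividedDiff_le_image (· + h) hs hsI h1 (add_left_injective h).injOn
    (fun x _ => by simpa using h3) fun x hx hxs => h2 x hx _ hxs rfl

theorem of_nConvexOn_deriv {f' : ℝ → ℝ} (hI : Convex ℝ I) (hf' : ∀ x ∈ I, HasDerivAt f (f' x) x)
    (h : NConvexOn n I f') : NConvexOn (n + 1) I f := by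
  rw [nConvexOn_iff_dividedDiff] at h ⊢
  intro s hs hsI
  set P := Lagrange.interpolate s id f
  have hPd : P.degree < s.card := Lagrange.degree_interpolate_lt f Function.injective_id.injOn
  have hPe : ∀ x ∈ s, P.eval x = f x := fun x hx =>
    Lagrange.eval_interpolate_at_node f Function.injective_id.injOn hx
  let e := s.orderEmbOfFin hs
  have hes : ∀ i, e i ∈ s := s.orderEmbOfFin_mem hs
  have hrolle : ∀ i : Fin (n + 2), ∃ z ∈ Set.Ioo (e i.castSucc) (e i.succ),
      f' z - P.derivative.eval z = 0 := by
    intro i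
    have hIcc : Set.Icc (e i.castSucc) (e i.succ) ⊆ I :=
      hI.ordConnected.out (hsI (hes _)) (hsI (hes _))
    have hd : ∀ x ∈ I, HasDerivAt (fun x => f x - P.eval x) (f' x - P.derivative.eval x) x :=
      fun x hx => (hf' x hx).sub (P.hasDerivAt x)
    refine exists_hasDerivAt_eq_zero (f := fun x => f x - P.eval x)
      (e.strictMono (Fin.castSucc_lt_succ (i := i)))
      (fun x hx => (hd x (hIcc hx)).continuousAt.continuousWithinAt) ?_
      fun x hx => hd x (hIcc (Set.Ioo_subset_Icc_self hx))
    simp only [hPe _ (hes _), sub_self]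
  choose ξ hξ hξ0 using hrolle
  have hmono : StrictMono ξ := Fin.strictMono_iff_lt_succ.2 fun i => by
    have h1 := (hξ i.castSucc).2
    have h2 := (hξ i.succ).1
    rw [Fin.succ_castSucc] at h1
    exact h1.trans h2
  set t := Finset.univ.image ξ with ht
  have htc : t.card = n + 2 := by
    rw [ht, Finset.card_image_of_injective _ hmono.injective, Finset.card_fin]
  have htI : (t : Set ℝ) ⊆ I := by
    intro z hz
    obtain ⟨i, -, rfl⟩ := Finset.mem_image.1 (Finset.mem_coe.1 hz)
    exact hI.ordConnected.out (hsI (hes _)) (hsI (hes _)) (Set.Ioo_subset_Icc_self (hξ i))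
  have hft : dividedDiff t f' = P.derivative.coeff (n + 1) := by
    have hdeg : P.derivative.degree < t.card := by
      rw [htc, Polynomial.degree_lt_iff_coeff_zero]
      intro m hm
      rw [hs, Polynomial.degree_lt_iff_coeff_zero] at hPd
      rw [Polynomial.coeff_derivative, hPd (m + 1) (by omega), zero_mul]
    have := dividedDiff_polynomial hdeg
    rw [htc] at this
    rw [← show n + 2 - 1 = n + 1 from rfl, ← this]
    refine dividedDiff_congr fun z hz => ?_
    obtain ⟨i, -, rfl⟩ := Finset.mem_image.1 hz
    exact sub_eq_zero.1 (hξ0 i)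
  have hfs : dividedDiff s f = P.coeff (n + 2) := by
    have := dividedDiff_polynomial hPd
    rw [hs] at this
    rw [← show n + 1 + 2 - 1 = n + 2 from rfl, ← this]
    exact dividedDiff_congr fun z hz => (hPe z hz).symm
  have h0 := h t htc htI
  rw [hft, Polynomial.coeff_derivative] at h0
  rw [hfs]
  exact nonneg_of_mul_nonneg_left h0 (by positivity)

end NConvexOn

theorem nConvexOn_add_two_iff {n : ℕ} {I : Set ℝ} (hIo : IsOpen I) (hI : Convex ℝ I) {f : ℝ → ℝ} :
    NConvexOn (n + 2) I f ↔ DifferentiableOn ℝ f I ∧ NConvexOn (n + 1) I (derivWithin f I) := by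
  have hderiv : DifferentiableOn ℝ f I → ∀ x ∈ I, HasDerivAt f (derivWithin f I x) x :=
    fun h x hx => (h x hx).hasDerivWithinAt.hasDerivAt (hIo.mem_nhds hx)
  constructor
  · intro h
    have hd : DifferentiableOn ℝ f I := fun x hx =>
      (NConvexOn.differentiableAt hIo h x hx).differentiableWithinAt
    exact ⟨hd, h.of_hasDerivAt hIo (hderiv hd)⟩
  · rintro ⟨hd, h⟩
    exact h.of_nConvexOn_deriv hI (hderiv hd)

theorem nConvexOn_succ_iff {I : Set ℝ} (hIo : IsOpen I) (hI : Convex ℝ I) (n : ℕ) (f : ℝ → ℝ) :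
    NConvexOn (n + 1) I f ↔
      ((∀ k < n, DifferentiableOn ℝ (iteratedDerivWithin k f I) I) ∧
        ConvexOn ℝ I (iteratedDerivWithin n f I)) := by
  induction n generalizing f with
  | zero => simp [nConvexOn_one_iff_convexOn hI]
  | succ n ih =>
    rw [nConvexOn_add_two_iff hIo hI, ih, Nat.forall_lt_succ_left', iteratedDerivWithin_zero]
    simp only [iteratedDerivWithin_succ', and_assoc]

/-- On a nonempty open interval `I`, `f` is `n`-convex iff `f` is `(n-1)`-times
differentiable on `I` and its `(n-1)`-st derivative is convex on `I`. -/
theorem nconvex_iff_iteratedDeriv_convex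
    (I : Set ℝ) (hIo : IsOpen I) (hIne : I.Nonempty) (hIconv : Convex ℝ I)
    (n : ℕ) (hn : 1 ≤ n) (f : ℝ → ℝ) :
    NConvexOn n I f ↔
      ((∀ k < n - 1, DifferentiableOn ℝ (iteratedDerivWithin k f I) I) ∧
        ConvexOn ℝ I (iteratedDerivWithin (n - 1) f I)) := by
  obtain ⟨m, rfl⟩ := Nat.exists_eq_add_of_le' hn
  exact nConvexOn_succ_iff hIo hIconv m f
end

section
/- Let n ∈ ℕ, n ≥ 1, let f : [a,b] → ℝ be (2n−1)-convex, and let x_1,…,x_n be pairwise distinct points of the open interval (a,b). Then there exists a polynomial p of degree at most 2n−1 such that p(x_i) = f(x_i) for i = 1,…,n and p(x) ≤ f(x) for all x ∈ [a,b]. -/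
open Polynomial Filter Topology

/-- Divided differences of an `n`-convex function over a finite set of nodes are nonnegative. -/
lemma NConvexOn.sum_div_prod_nonneg_s6 {n : ℕ} {s : Set ℝ} {f : ℝ → ℝ} (hf : NConvexOn n s f)
    (S : Finset ℝ) (hS : S.card = n + 2) (hSs : ∀ y ∈ S, y ∈ s) :
    0 ≤ ∑ y ∈ S, f y / ∏ z ∈ S.erase y, (y - z) := by
  set e : Fin (n + 2) ↪ ℝ := (S.orderEmbOfFin hS).toEmbedding
  have he : S = Finset.univ.map e := (S.map_orderEmbOfFin_univ hS).symm
  have h := hf e e.injective fun i => hSs _ (S.orderEmbOfFin_mem hS i)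
  rw [he, Finset.sum_map]
  refine h.trans_eq (Finset.sum_congr rfl fun i _ => ?_)
  rw [← Finset.map_erase, Finset.prod_map]

/-- The error of interpolating an `n`-convex function at `n + 1` nodes has the sign of the
nodal polynomial. -/
lemma NConvexOn.eval_le_of_prod_pos {n : ℕ} {s : Set ℝ} {f : ℝ → ℝ} (hf : NConvexOn n s f)
    {S : Finset ℝ} (hS : S.card = n + 1) (hSs : ∀ y ∈ S, y ∈ s) {p : ℝ[X]}
    (hp : p.degree < (n + 1 : ℕ)) (hpf : ∀ y ∈ S, p.eval y = f y) {t : ℝ} (ht : t ∈ s)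
    (hpos : 0 < ∏ z ∈ S, (t - z)) : p.eval t ≤ f t := by
  have htS : t ∉ S := fun h => hpos.ne' (Finset.prod_eq_zero h (sub_self t))
  have hcard : (insert t S).card = n + 2 := by rw [Finset.card_insert_of_notMem htS, hS]
  have hf0 := hf.sum_div_prod_nonneg_s6 (insert t S) hcard (by
    simpa [Finset.forall_mem_insert] using ⟨ht, hSs⟩)
  have hp0 := Lagrange.coeff_eq_sum (s := insert t S) (v := id) (Set.injOn_id _) (P := p)
    (hp.trans (by rw [hcard]; exact_mod_cast Nat.lt_succ_self _))
  rw [hcard, coeff_eq_zero_of_degree_lt (by simpa using hp)] at hp0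
  simp only [id] at hp0
  rw [Finset.sum_insert htS, Finset.erase_insert htS] at hf0 hp0
  have hrest : ∑ y ∈ S, f y / ∏ z ∈ (insert t S).erase y, (y - z) =
      ∑ y ∈ S, p.eval y / ∏ z ∈ (insert t S).erase y, (y - z) :=
    Finset.sum_congr rfl fun y hy => by rw [hpf y hy]
  rw [hrest] at hf0
  have : p.eval t / ∏ z ∈ S, (t - z) ≤ f t / ∏ z ∈ S, (t - z) := by linarith
  exact (div_le_div_iff_of_pos_right hpos).1 this

lemma degree_interpolate_univ_lt {n : ℕ} {x : Fin n → ℝ} (hx : Function.Injective x)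
    (c : Fin n → ℝ) : (Lagrange.interpolate Finset.univ x c).degree < n :=
  (Lagrange.degree_interpolate_lt c hx.injOn).trans_eq (by simp)

/-- A polynomial of degree less than `n` that is bounded at `n` separated points is bounded. -/
lemma abs_eval_le_of_abs_eval_nodes_le {n : ℕ} {r : ℝ[X]} (hr : r.degree < n) {ξ : Fin n → ℝ}
    {δ B M y : ℝ} (hδ : 0 < δ) (hM : 0 ≤ M) (hsep : ∀ i j, i ≠ j → δ ≤ |ξ i - ξ j|)
    (hB : ∀ i, |y - ξ i| ≤ B) (hrM : ∀ i, |r.eval (ξ i)| ≤ M) :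
    |r.eval y| ≤ n * (M * (δ⁻¹ * B) ^ (n - 1)) := by
  have hinj : Set.InjOn ξ (Finset.univ : Finset (Fin n)) := by
    intro i _ j _ hij
    by_contra hne
    have := hsep i j hne
    rw [hij, sub_self, abs_zero] at this
    linarith
  rw [Lagrange.eq_interpolate (f := r) hinj (by simpa using hr), Lagrange.interpolate_apply,
    eval_finsetSum]
  refine (Finset.abs_sum_le_sum_abs _ _).trans ?_
  have key : ∀ i ∈ (Finset.univ : Finset (Fin n)),
      |eval y (C (eval (ξ i) r) * Lagrange.basis Finset.univ ξ i)| ≤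
        M * (δ⁻¹ * B) ^ (n - 1) := by
    intro i _
    rw [eval_mul, eval_C, abs_mul]
    refine mul_le_mul (hrM i) ?_ (abs_nonneg _) hM
    rw [Lagrange.basis, eval_prod, Finset.abs_prod]
    have hc : (Finset.univ.erase i).card = n - 1 := by simp
    rw [← hc]
    rw [← Finset.prod_const]
    refine Finset.prod_le_prod (fun j _ => abs_nonneg _) fun j hj => ?_
    have hij := hsep i j (Finset.ne_of_mem_erase hj).symm
    rw [Lagrange.basisDivisor, eval_mul, eval_C, eval_sub, eval_X, eval_C, abs_mul, abs_inv]
    gcongr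
    exact hB j
  simpa using Finset.sum_le_card_nsmul _ _ _ key

/-- If `nodal * r` is bounded above on both sides of each node, then the values of `r` at
the nodes are bounded, uniformly in `r`. -/
lemma exists_abs_eval_le_of_nodal_mul_le {n : ℕ} {x : Fin n → ℝ} {a b δ G : ℝ} (hδ : 0 < δ)
    (hG : 0 ≤ G) (hsep : ∀ i j, i ≠ j → 3 * δ ≤ |x i - x j|)
    (hmem : ∀ i, a ≤ x i - δ ∧ x i + δ ≤ b) :
    ∃ K, ∀ r : ℝ[X], r.degree < n →
      (∀ i, (Lagrange.nodal Finset.univ x * r).eval (x i + δ) ≤ G ∧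
        (Lagrange.nodal Finset.univ x * r).eval (x i - δ) ≤ G) →
      ∀ j, |r.eval (x j)| ≤ K := by
  refine ⟨n * (G / δ / δ ^ (n - 1) * (δ⁻¹ * (b - a)) ^ (n - 1)), fun r hr hrG j => ?_⟩
  have hξ : ∀ i, ∃ ξ ∈ Set.Icc (x i - δ) (x i + δ), |r.eval ξ| ≤ G / δ / δ ^ (n - 1) := by
    intro i
    set φ : ℝ[X] := Lagrange.nodal (Finset.univ.erase i) x * r with hφ
    have hfac : Lagrange.nodal Finset.univ x * r = (X - C (x i)) * φ := by
      rw [hφ, Lagrange.nodal_eq_mul_nodal_erase (Finset.mem_univ i), mul_assoc]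
    obtain ⟨h1, h2⟩ := hrG i
    rw [hfac, eval_mul, eval_sub, eval_X, eval_C] at h1 h2
    have h1' : φ.eval (x i + δ) ≤ G / δ := by
      rw [le_div_iff₀ hδ]; linarith
    have h2' : -(G / δ) ≤ φ.eval (x i - δ) := by
      rw [← neg_div, div_le_iff₀ hδ]; linarith
    have hG' : 0 ≤ G / δ := by positivity
    obtain ⟨ξ, hξ, hφξ⟩ : ∃ ξ ∈ Set.Icc (x i - δ) (x i + δ), |φ.eval ξ| ≤ G / δ := by
      rcases le_or_gt (φ.eval (x i - δ)) (G / δ) with h | h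
      · exact ⟨x i - δ, ⟨le_rfl, by linarith⟩, abs_le.2 ⟨h2', h⟩⟩
      · obtain ⟨ξ, hξ, he⟩ := intermediate_value_Icc' (by linarith : x i - δ ≤ x i + δ)
          φ.continuous.continuousOn ⟨h1', h.le⟩
        exact ⟨ξ, hξ, by simp only [he]; exact (abs_of_nonneg hG').le⟩
    refine ⟨ξ, hξ, ?_⟩
    have hW : δ ^ (n - 1) ≤ |(Lagrange.nodal (Finset.univ.erase i) x).eval ξ| := by
      rw [Lagrange.eval_nodal, Finset.abs_prod]
      have hc : (Finset.univ.erase i).card = n - 1 := by simp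
      rw [← hc]
      rw [← Finset.prod_const]
      refine Finset.prod_le_prod (fun _ _ => hδ.le) fun k hk => ?_
      have hik := hsep i k (Finset.ne_of_mem_erase hk).symm
      have : |x i - ξ| ≤ δ := abs_le.2 ⟨by linarith [hξ.2], by linarith [hξ.1]⟩
      have := abs_sub_le (x i) ξ (x k)
      linarith
    rw [le_div_iff₀ (by positivity)]
    rw [hφ, eval_mul, abs_mul, mul_comm] at hφξ
    exact (mul_le_mul_of_nonneg_left hW (abs_nonneg _)).trans hφξ
  choose ξ hξ hrξ using hξ
  refine abs_eval_le_of_abs_eval_nodes_le hr hδ (by positivity) (fun i k hik => ?_)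
    (fun i => ?_) hrξ
  · have h1 : |x i - ξ i| ≤ δ := abs_le.2 ⟨by linarith [(hξ i).2], by linarith [(hξ i).1]⟩
    have h2 : |ξ k - x k| ≤ δ := abs_le.2 ⟨by linarith [(hξ k).1], by linarith [(hξ k).2]⟩
    have h3 := abs_sub_le (x i) (ξ i) (x k)
    have h4 := abs_sub_le (ξ i) (ξ k) (x k)
    linarith [hsep i k hik]
  · have := hmem i
    have := hmem j
    exact abs_le.2 ⟨by linarith [(hξ i).2], by linarith [(hξ i).1]⟩

/-- Interpolating at the nodes `x i` and `x i + h`, for small `h > 0`, gives a polynomial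
lying below `f` outside the intervals `[x i, x i + h]`. -/
lemma NConvexOn.eventually_exists_interpolant_le {n : ℕ} (hn : 1 ≤ n) {a b : ℝ} {f : ℝ → ℝ}
    (hf : NConvexOn (2 * n - 1) (Set.Icc a b) f) {x : Fin n → ℝ} (hxinj : Function.Injective x)
    (hx : ∀ i, x i ∈ Set.Ioo a b) :
    ∀ᶠ h in 𝓝[>] (0 : ℝ), ∃ r : ℝ[X], r.degree < n ∧
      ∀ t ∈ Set.Icc a b, (∀ i, 0 < (t - x i) * (t - (x i + h))) →
        (Lagrange.interpolate Finset.univ x (fun i => f (x i)) +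
          Lagrange.nodal Finset.univ x * r).eval t ≤ f t := by
  have hne : ∀ᶠ h in 𝓝[>] (0 : ℝ), ∀ i j, x j ≠ x i + h := by
    simp only [eventually_all]
    intro i j
    by_cases hij : i = j
    · subst hij
      filter_upwards [self_mem_nhdsWithin] with h hh he
      rw [Set.mem_Ioi] at hh
      linarith
    · have : x j - x i ≠ 0 := sub_ne_zero.2 fun h => hij (hxinj h.symm)
      filter_upwards [(eventually_ne_nhds this.symm).filter_mono nhdsWithin_le_nhds] with h hh he
      exact hh (by linarith)
  have hlt : ∀ᶠ h in 𝓝[>] (0 : ℝ), ∀ i, h < b - x i := by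
    simp only [eventually_all]
    exact fun i => (eventually_lt_nhds (sub_pos.2 (hx i).2)).filter_mono nhdsWithin_le_nhds
  filter_upwards [hne, hlt, self_mem_nhdsWithin] with h hne hlt hh
  rw [Set.mem_Ioi] at hh
  set S₁ := Finset.univ.image x
  set S₂ := Finset.univ.image fun i => x i + h
  have hinj₂ : Function.Injective fun i => x i + h := fun i j hij =>
    hxinj (add_right_cancel hij)
  have hdisj : Disjoint S₁ S₂ := by
    rw [Finset.disjoint_left]
    simp only [S₁, S₂, Finset.mem_image, Finset.mem_univ, true_and]
    rintro _ ⟨j, rfl⟩ ⟨i, hi⟩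
    exact hne i j hi.symm
  have hcard : (S₁ ∪ S₂).card = 2 * n - 1 + 1 := by
    rw [Finset.card_union_of_disjoint hdisj, Finset.card_image_of_injective _ hxinj,
      Finset.card_image_of_injective _ hinj₂, Finset.card_univ, Fintype.card_fin]
    omega
  set p := Lagrange.interpolate (S₁ ∪ S₂) id f
  set q := Lagrange.interpolate Finset.univ x (fun i => f (x i))
  have hpdeg : p.degree < (2 * n - 1 + 1 : ℕ) := by
    rw [← hcard]; exact Lagrange.degree_interpolate_lt _ (Set.injOn_id _)
  have hqdeg : q.degree < n := degree_interpolate_univ_lt hxinj _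
  have hpS : ∀ y ∈ S₁ ∪ S₂, p.eval y = f y := fun y hy =>
    Lagrange.eval_interpolate_at_node (v := id) f (Set.injOn_id _) hy
  have hdvd : Lagrange.nodal Finset.univ x ∣ p - q := by
    refine Finset.prod_dvd_of_coprime
      (fun i _ j _ hij => pairwise_coprime_X_sub_C hxinj hij) fun i _ => ?_
    rw [dvd_iff_isRoot, IsRoot, eval_sub, hpS _ (by simp [S₁]),
      Lagrange.eval_interpolate_at_node _ hxinj.injOn (Finset.mem_univ i), sub_self]
  obtain ⟨r, hr⟩ := hdvd
  have hpq : p = q + Lagrange.nodal Finset.univ x * r := by rw [← hr]; ring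
  refine ⟨r, ?_, fun t ht hpos => ?_⟩
  · by_contra! hrn
    have h1 : (p - q).degree < (2 * n : ℕ) := by
      refine (degree_sub_le _ _).trans_lt (max_lt ?_ ?_)
      · rwa [show 2 * n - 1 + 1 = 2 * n by omega] at hpdeg
      · exact hqdeg.trans_le (by exact_mod_cast (by omega : n ≤ 2 * n))
    rw [hr, degree_mul, Lagrange.degree_nodal, Finset.card_univ, Fintype.card_fin] at h1
    have h2 : ((2 * n : ℕ) : WithBot ℕ) ≤ n + r.degree := by
      rw [two_mul, Nat.cast_add]; gcongr
    exact absurd h1 h2.not_gt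
  · rw [← hpq]
    refine hf.eval_le_of_prod_pos hcard ?_ hpdeg hpS ht ?_
    · simp only [S₁, S₂, Finset.mem_union, Finset.mem_image, Finset.mem_univ, true_and]
      rintro _ (⟨i, rfl⟩ | ⟨i, rfl⟩)
      · exact Set.Ioo_subset_Icc_self (hx i)
      · exact ⟨by linarith [(hx i).1], by linarith [hlt i]⟩
    · rw [Finset.prod_union hdisj, Finset.prod_image hxinj.injOn, Finset.prod_image hinj₂.injOn,
        ← Finset.prod_mul_distrib]
      exact Finset.prod_pos fun i _ => hpos i

/-- Support theorem (Gauss type): a `(2n-1)`-convex function on `[a,b]` admits,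
for any `n` pairwise distinct points of `(a,b)`, a polynomial of degree at most
`2n-1` interpolating it at these points and supporting it from below on `[a,b]`. -/
theorem nconvex_support_below_interior_nodes
    (n : ℕ) (hn : 1 ≤ n) (a b : ℝ) (hab : a < b) (f : ℝ → ℝ)
    (hf : NConvexOn (2 * n - 1) (Set.Icc a b) f)
    (x : Fin n → ℝ) (hxinj : Function.Injective x)
    (hx : ∀ i, x i ∈ Set.Ioo a b) :
    ∃ p : Polynomial ℝ, p.natDegree ≤ 2 * n - 1 ∧
      (∀ i, p.eval (x i) = f (x i)) ∧
      (∀ t ∈ Set.Icc a b, p.eval t ≤ f t) := by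
  set q := Lagrange.interpolate Finset.univ x (fun i => f (x i)) with hq
  set w := Lagrange.nodal Finset.univ x with hw
  have hqdeg : q.degree < n := degree_interpolate_univ_lt hxinj _
  obtain ⟨r, hr⟩ := (hf.eventually_exists_interpolant_le hn hxinj hx).choice
  simp only [← hq, ← hw] at hr
  have hle : ∀ t ∈ Set.Icc a b, (∀ i, t ≠ x i) →
      ∀ᶠ h in 𝓝[>] (0 : ℝ), (q + w * r h).eval t ≤ f t := by
    intro t ht htx
    have hpos : ∀ᶠ h in 𝓝[>] (0 : ℝ), ∀ i, 0 < (t - x i) * (t - (x i + h)) := by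
      simp only [eventually_all]
      intro i
      have hc : ContinuousAt (fun h : ℝ => (t - x i) * (t - (x i + h))) 0 := by fun_prop
      refine (hc.eventually (lt_mem_nhds ?_)).filter_mono nhdsWithin_le_nhds
      simp only [add_zero]
      exact mul_self_pos.2 (sub_ne_zero.2 (htx i))
    filter_upwards [hr, hpos] with h hr hpos using hr.2 t ht hpos
  obtain ⟨δ, ⟨hsep, hmem⟩, hδ⟩ : ∃ δ : ℝ, ((∀ i j, i ≠ j → 3 * δ < |x i - x j|) ∧
      ∀ i, a < x i - δ ∧ x i + δ < b) ∧ 0 < δ := by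
    have h1 : ∀ᶠ δ in 𝓝[>] (0 : ℝ), ∀ i j, i ≠ j → 3 * δ < |x i - x j| := by
      simp only [eventually_all]
      intro i j hij
      have hc : ContinuousAt (fun δ : ℝ => 3 * δ) 0 := by fun_prop
      refine (hc.eventually (gt_mem_nhds ?_)).filter_mono nhdsWithin_le_nhds
      simpa [sub_eq_zero] using hxinj.ne hij
    have h2 : ∀ᶠ δ in 𝓝[>] (0 : ℝ), ∀ i, a < x i - δ ∧ x i + δ < b := by
      simp only [eventually_all]
      intro i
      have hc : ContinuousAt (fun δ : ℝ => x i - δ) 0 := by fun_prop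
      have hc' : ContinuousAt (fun δ : ℝ => x i + δ) 0 := by fun_prop
      exact ((hc.eventually (lt_mem_nhds (by simpa using (hx i).1))).and
        (hc'.eventually (gt_mem_nhds (by simpa using (hx i).2)))).filter_mono nhdsWithin_le_nhds
    exact ((h1.and h2).and self_mem_nhdsWithin).exists
  have hoff : ∀ i j, x i + δ ≠ x j ∧ x i - δ ≠ x j := by
    intro i j
    by_cases hij : i = j
    · subst hij
      exact ⟨by linarith, by linarith⟩
    · have := hsep i j hij
      constructor <;> intro h <;> rw [← h] at this
      · rw [show x i - (x i + δ) = -δ by ring, abs_neg, abs_of_pos hδ] at this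
        linarith
      · rw [show x i - (x i - δ) = δ by ring, abs_of_pos hδ] at this
        linarith
  set g : ℝ → ℝ := fun t => |f t - q.eval t|
  set G := ∑ i, (g (x i + δ) + g (x i - δ))
  have hg : ∀ t, 0 ≤ g t := fun t => abs_nonneg _
  have hgG : ∀ i, g (x i + δ) + g (x i - δ) ≤ G := fun i =>
    Finset.single_le_sum (f := fun i => g (x i + δ) + g (x i - δ))
      (fun i _ => add_nonneg (hg _) (hg _)) (Finset.mem_univ i)
  obtain ⟨K, hK⟩ := exists_abs_eval_le_of_nodal_mul_le (G := G) hδ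
    (Finset.sum_nonneg fun i _ => add_nonneg (hg _) (hg _))
    (fun i j hij => (hsep i j hij).le) fun i => ⟨(hmem i).1.le, (hmem i).2.le⟩
  have hbdd : ∀ᶠ h in 𝓝[>] (0 : ℝ),
      (fun i => (r h).eval (x i)) ∈ Set.pi Set.univ fun _ : Fin n => Set.Icc (-K) K := by
    have hside : ∀ᶠ h in 𝓝[>] (0 : ℝ), ∀ i,
        (q + w * r h).eval (x i + δ) ≤ f (x i + δ) ∧
        (q + w * r h).eval (x i - δ) ≤ f (x i - δ) := by
      simp only [eventually_all]
      intro i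
      have := hmem i
      exact (hle _ ⟨by linarith, by linarith⟩ fun j => (hoff i j).1).and
        (hle _ ⟨by linarith, by linarith⟩ fun j => (hoff i j).2)
    filter_upwards [hr, hside] with h hr hside
    intro j _
    refine abs_le.1 (hK (r h) hr.1 (fun i => ?_) j)
    obtain ⟨h1, h2⟩ := hside i
    rw [eval_add] at h1 h2
    have := hgG i
    have := hg (x i + δ)
    have := hg (x i - δ)
    have := le_abs_self (f (x i + δ) - q.eval (x i + δ))
    have := le_abs_self (f (x i - δ) - q.eval (x i - δ))
    constructor <;> linarith
  set U : Ultrafilter ℝ := Ultrafilter.of (𝓝[>] (0 : ℝ))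
  have hU : (U : Filter ℝ) ≤ 𝓝[>] 0 := Ultrafilter.of_le _
  obtain ⟨c, -, hc⟩ := (isCompact_univ_pi fun _ : Fin n => isCompact_Icc).ultrafilter_le_nhds'
    (U.map fun h i => (r h).eval (x i)) (hU hbdd)
  have hc : ∀ i, Tendsto (fun h => (r h).eval (x i)) U (𝓝 (c i)) := tendsto_pi_nhds.1 hc
  set s := Lagrange.interpolate Finset.univ x c
  have hsdeg : s.degree < n := degree_interpolate_univ_lt hxinj c
  have hs : ∀ t, Tendsto (fun h => (r h).eval t) U (𝓝 (s.eval t)) := by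
    intro t
    have h1 : Tendsto (fun h => ∑ i, (r h).eval (x i) *
        (Lagrange.basis Finset.univ x i).eval t) U (𝓝 (s.eval t)) := by
      simp only [s, Lagrange.interpolate_apply, eval_finsetSum, eval_mul, eval_C]
      exact tendsto_finsetSum _ fun i _ => (hc i).mul_const _
    refine h1.congr' ?_
    filter_upwards [hU hr] with h hr
    conv_rhs => rw [Lagrange.eq_interpolate (f := r h) (s := Finset.univ) (v := x) hxinj.injOn
      (by simpa using hr.1)]
    simp [Lagrange.interpolate_apply, eval_finsetSum]
  have hnode : ∀ i, (q + w * s).eval (x i) = f (x i) := by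
    intro i
    rw [eval_add, eval_mul, hw, Lagrange.eval_nodal_at_node (Finset.mem_univ i), zero_mul,
      add_zero, hq, Lagrange.eval_interpolate_at_node _ hxinj.injOn (Finset.mem_univ i)]
  refine ⟨q + w * s, ?_, hnode, fun t ht => ?_⟩
  · have hnat : ∀ p : ℝ[X], p.degree < n → p.natDegree < n := by
      intro p hp
      rcases eq_or_ne p 0 with rfl | h
      · simpa using Nat.pos_of_ne_zero (by omega : n ≠ 0)
      · exact (natDegree_lt_iff_degree_lt h).2 hp
    have hqn : q.natDegree < n := hnat _ hqdeg
    have hsn : s.natDegree < n := hnat _ hsdeg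
    have hwn : w.natDegree = n := by simp [w, Lagrange.natDegree_nodal]
    have := natDegree_mul_le (p := w) (q := s)
    exact natDegree_add_le_of_degree_le (by omega) (by omega)
  · by_cases htx : ∃ i, t = x i
    · obtain ⟨i, rfl⟩ := htx
      exact (hnode i).le
    · push Not at htx
      refine le_of_tendsto (f := fun h => (q + w * r h).eval t) (x := (U : Filter ℝ)) ?_
        (hU (hle t ht htx))
      simp only [eval_add, eval_mul]
      exact ((hs t).const_mul _).const_add _
end

section
/- Let n ∈ ℕ, n ≥ 1, let f : [a,b] → ℝ be (2n−1)-convex, and let x_1 = a, x_{n+1} = b, and x_2,…,x_n be pairwise distinct points of the open interval (a,b). Then there exists a polynomial p of degree at most 2n−1 such that p(x_i) = f(x_i) for i = 1,…,n+1 and p(x) ≥ f(x) for all x ∈ [a,b]. -/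
section

open Finset Filter Topology Polynomial

/-- The divided-difference condition of `NConvexOn`, indexed by a finite set of reals. -/
lemma NConvexOn.sum_nonneg {m : ℕ} {s : Set ℝ} {f : ℝ → ℝ} (hf : NConvexOn m s f)
    {Z : Finset ℝ} (hZ : #Z = m + 2) (hZs : ∀ z ∈ Z, z ∈ s) :
    0 ≤ ∑ z ∈ Z, f z / ∏ w ∈ Z.erase z, (z - w) := by
  have key := hf (Z.orderEmbOfFin hZ) (Z.orderEmbOfFin hZ).injective
    fun i => hZs _ (Z.orderEmbOfFin_mem hZ i)
  have hmap : (univ : Finset (Fin (m + 2))).map (Z.orderEmbOfFin hZ).toEmbedding = Z :=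
    Z.map_orderEmbOfFin_univ hZ
  refine key.trans_eq ?_
  conv_rhs => rw [← hmap, sum_map]
  refine sum_congr rfl fun i _ => ?_
  rw [← map_erase, prod_map]
  rfl

/-- Divided differences of order exceeding the degree of a polynomial vanish. -/
lemma sum_eval_div_prod_eq_zero {Z : Finset ℝ} {p : ℝ[X]} (hp : p.degree < (#Z - 1 : ℕ)) :
    ∑ z ∈ Z, p.eval z / ∏ w ∈ Z.erase z, (z - w) = 0 := by
  have hlt : p.degree < (#Z : ℕ) := hp.trans_le (by exact_mod_cast Nat.sub_le _ _)
  have h := Lagrange.coeff_eq_sum (s := Z) (v := id) Function.injective_id.injOn hlt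
  rw [coeff_eq_zero_of_degree_lt hp] at h
  exact h.symm

/-- A polynomial interpolating an `m`-convex function at `m + 1` points lies above it wherever the
nodal polynomial is negative. -/
lemma NConvexOn.le_eval_interpolate {m : ℕ} {s : Set ℝ} {f : ℝ → ℝ} (hf : NConvexOn m s f)
    {Y : Finset ℝ} (hY : #Y = m + 1) (hYs : ∀ y ∈ Y, y ∈ s) {t : ℝ} (ht : t ∈ s)
    (hneg : ∏ y ∈ Y, (t - y) < 0) : f t ≤ (Lagrange.interpolate Y id f).eval t := by
  have htY : t ∉ Y := fun h => hneg.ne (prod_eq_zero h (sub_self t))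
  have hcard : #(insert t Y) = m + 2 := by rw [card_insert_of_notMem htY, hY]
  have h1 := hf.sum_nonneg hcard (by simpa [ht] using hYs)
  have h2 := sum_eval_div_prod_eq_zero (Z := insert t Y) (p := Lagrange.interpolate Y id f) (by
    have := Lagrange.degree_interpolate_lt (s := Y) (v := id) f Function.injective_id.injOn
    rw [hcard]
    rwa [hY] at this)
  rw [sum_insert htY, erase_insert htY] at h1 h2
  have h3 : ∑ z ∈ Y, (Lagrange.interpolate Y id f).eval z / ∏ w ∈ (insert t Y).erase z, (z - w)
      = ∑ z ∈ Y, f z / ∏ w ∈ (insert t Y).erase z, (z - w) :=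
    sum_congr rfl fun z hz => by
      have := Lagrange.eval_interpolate_at_node (s := Y) (v := id) f Function.injective_id.injOn hz
      rw [id] at this
      rw [this]
  rw [h3] at h2
  have h4 : (Lagrange.interpolate Y id f).eval t / ∏ y ∈ Y, (t - y)
      ≤ f t / ∏ y ∈ Y, (t - y) := by linarith
  exact (div_le_div_right_of_neg hneg).1 h4

/-- Polynomials of degree less than `#Z - 1` whose values at the points of `Z` satisfy suitable
one-sided bounds converge pointwise along any ultrafilter. -/
lemma exists_tendsto_eval_of_eventually_div_le {ι : Type*} (U : Ultrafilter ι) (p : ι → ℝ[X])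
    {Z : Finset ℝ} (hZ : Z.Nonempty) (hdeg : ∀ᶠ i in (U : Filter ι), (p i).degree < (#Z - 1 : ℕ)) (c : ℝ → ℝ)
    (hc : ∀ z ∈ Z, ∀ᶠ i in (U : Filter ι), (p i).eval z / ∏ w ∈ Z.erase z, (z - w) ≤ c z) :
    ∃ q : ℝ[X], q.degree < (#Z - 1 : ℕ) ∧
      ∀ t, Tendsto (fun i => (p i).eval t) U (𝓝 (q.eval t)) := by
  have hlim : ∀ z ∈ Z, ∃ l, Tendsto (fun i => (p i).eval z) U (𝓝 l) := by
    intro z hz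
    have hW : ∏ w ∈ Z.erase z, (z - w) ≠ 0 :=
      prod_ne_zero_iff.2 fun w hw => sub_ne_zero.2 (ne_of_mem_erase hw).symm
    obtain ⟨l, -, hl⟩ := isCompact_iff_ultrafilter_le_nhds'.1
      (isCompact_Icc (a := -∑ w ∈ Z.erase z, c w) (b := c z))
      (U.map fun i => (p i).eval z / ∏ w ∈ Z.erase z, (z - w)) (by
        rw [Ultrafilter.mem_map]
        change ∀ᶠ i in (U : Filter ι), _
        filter_upwards [hdeg, (eventually_all_finset Z).2 hc] with i hi hci
        refine ⟨?_, hci z hz⟩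
        have h0 := sum_eval_div_prod_eq_zero hi
        rw [← add_sum_erase _ _ hz] at h0
        have := sum_le_sum fun w (hw : w ∈ Z.erase z) => hci w (mem_of_mem_erase hw)
        linarith)
    refine ⟨l * ∏ w ∈ Z.erase z, (z - w), ?_⟩
    have hl' : Tendsto (fun i => (p i).eval z / ∏ w ∈ Z.erase z, (z - w)) U (𝓝 l) := hl
    simpa [div_mul_cancel₀ _ hW] using hl'.mul_const (∏ w ∈ Z.erase z, (z - w))
  choose! l hl using hlim
  obtain ⟨z₀, hz₀⟩ := hZ
  have hcard : #(Z.erase z₀) = #Z - 1 := card_erase_of_mem hz₀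
  refine ⟨Lagrange.interpolate (Z.erase z₀) id l, ?_, fun t => ?_⟩
  · rw [← hcard]
    exact Lagrange.degree_interpolate_lt _ Function.injective_id.injOn
  · have heq : (fun i => ∑ z ∈ Z.erase z₀, (p i).eval z *
        (Lagrange.basis (Z.erase z₀) id z).eval t) =ᶠ[(U : Filter ι)] fun i => (p i).eval t := by
      filter_upwards [hdeg] with i hi
      rw [← hcard] at hi
      conv_rhs => rw [Lagrange.eq_interpolate (v := id) Function.injective_id.injOn hi]
      simp [Lagrange.interpolate_apply, eval_finsetSum]
    refine Tendsto.congr' heq ?_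
    simp only [Lagrange.interpolate_apply, eval_finsetSum, eval_mul, eval_C]
    exact tendsto_finsetSum _ fun z hz => (hl z (mem_of_mem_erase hz)).mul_const _

lemma eventually_nhdsGT_add_ne (x y : ℝ) : ∀ᶠ h in 𝓝[>] (0 : ℝ), x + h ≠ y := by
  rcases eq_or_ne x y with rfl | hxy
  · filter_upwards [self_mem_nhdsWithin] with h hh
    simpa using (ne_of_gt hh)
  · have : Tendsto (fun h => x + h) (𝓝 0) (𝓝 x) := by
      simpa using (tendsto_id (α := ℝ) (x := 𝓝 0)).const_add x
    exact (this.eventually_ne hxy).filter_mono nhdsWithin_le_nhds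

lemma eventually_nhdsGT_add_lt {x y : ℝ} (hxy : x < y) : ∀ᶠ h in 𝓝[>] (0 : ℝ), x + h < y := by
  have : Tendsto (fun h => x + h) (𝓝 0) (𝓝 x) := by
    simpa using (tendsto_id (α := ℝ) (x := 𝓝 0)).const_add x
  exact (this.eventually_lt_const hxy).filter_mono nhdsWithin_le_nhds

lemma eventually_nhdsGT_mul_pos {t x : ℝ} (htx : t ≠ x) :
    ∀ᶠ h in 𝓝[>] (0 : ℝ), 0 < (t - x) * (t - (x + h)) := by
  have : Tendsto (fun h => (t - x) * (t - (x + h))) (𝓝 0) (𝓝 ((t - x) * (t - x))) := by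
    have h : Continuous fun h : ℝ => (t - x) * (t - (x + h)) := by fun_prop
    simpa using h.tendsto 0
  exact (this.eventually_const_lt (mul_self_pos.2 (sub_ne_zero.2 htx))).filter_mono
    nhdsWithin_le_nhds

/-- At the shifted points the derivative of the nodal polynomial of
`A ∪ (A + δ) ∪ {b}` is negative, for `δ > 0` small. -/
lemma prod_erase_shift_neg {A : Finset ℝ} {b δ x : ℝ} (hδ : 0 < δ) (hx : x ∈ A)
    (hb : ∀ y ∈ A, y + δ < b) (hne : ∀ y ∈ A, ∀ z ∈ A, y + δ ≠ z) (hbA : b ∉ A)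
    (hpos : ∀ y ∈ A, y ≠ x → 0 < (x - y) * (x + δ - y)) :
    ∏ w ∈ (insert b (A ∪ A.map (addRightEmbedding δ))).erase (x + δ), (x + δ - w) < 0 := by
  have hxA : x + δ ∉ A := fun h => hne x hx _ h rfl
  have hset : (insert b (A ∪ A.map (addRightEmbedding δ))).erase (x + δ)
      = insert b (A ∪ (A.erase x).map (addRightEmbedding δ)) := by
    rw [erase_insert_of_ne (hb x hx).ne', erase_union_distrib, erase_eq_of_notMem hxA, map_erase]
    rfl
  have hbn : b ∉ A ∪ (A.erase x).map (addRightEmbedding δ) := by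
    simp only [mem_union, Finset.mem_map, addRightEmbedding_apply, mem_erase, not_or, not_exists, not_and]
    exact ⟨hbA, fun y hy => (hb y hy.2).ne⟩
  have hdisj : Disjoint A ((A.erase x).map (addRightEmbedding δ)) := by
    rw [disjoint_left]
    simp only [Finset.mem_map, addRightEmbedding_apply, mem_erase, not_exists, not_and]
    exact fun z hz y hy => hne y hy.2 z hz
  rw [hset, prod_insert hbn, prod_union hdisj, prod_map, ← mul_prod_erase A _ hx, mul_assoc,
    ← prod_mul_distrib]
  refine mul_neg_of_neg_of_pos (sub_neg.2 (hb x hx)) (mul_pos (by simpa using hδ) ?_)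
  refine prod_pos fun y hy => ?_
  have := hpos y (mem_of_mem_erase hy) (ne_of_mem_erase hy)
  simp only [addRightEmbedding_apply, add_sub_add_right_eq_sub]
  linarith

/-- The support theorem with the interior nodes given as a finite set. -/
lemma NConvexOn.exists_support_above {X : Finset ℝ} {a b : ℝ} (hab : a < b) {f : ℝ → ℝ}
    (hf : NConvexOn (2 * #X + 1) (Set.Icc a b) f) (hX : ∀ x ∈ X, x ∈ Set.Ioo a b) :
    ∃ p : ℝ[X], p.degree < (2 * #X + 2 : ℕ) ∧ p.eval a = f a ∧ p.eval b = f b ∧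
      (∀ x ∈ X, p.eval x = f x) ∧ ∀ t ∈ Set.Icc a b, f t ≤ p.eval t := by
  let Y : ℝ → Finset ℝ := fun h => insert a (insert b (X ∪ X.map (addRightEmbedding h)))
  let p : ℝ → ℝ[X] := fun h => Lagrange.interpolate (Y h) id f
  let U : Ultrafilter ℝ := Ultrafilter.of (𝓝[>] 0)
  have hU : (U : Filter ℝ) ≤ 𝓝[>] 0 := Ultrafilter.of_le _
  have haX : a ∉ X := fun h => (hX a h).1.false
  have hbX : b ∉ X := fun h => (hX b h).2.false
  have hnode : ∀ h, ∀ t ∈ insert a (insert b X), (p h).eval t = f t := by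
    intro h t ht
    refine Lagrange.eval_interpolate_at_node (s := Y h) (v := id) f Function.injective_id.injOn ?_
    simp only [Y, mem_insert, mem_union] at ht ⊢
    tauto
  have hgood : ∀ᶠ h in 𝓝[>] (0 : ℝ), 0 < h ∧ (∀ x ∈ X, x + h < b) ∧
      ∀ x ∈ X, ∀ y ∈ X, x + h ≠ y :=
    Filter.Eventually.and self_mem_nhdsWithin
      (((eventually_all_finset X).2 fun x hx => eventually_nhdsGT_add_lt (hX x hx).2).and
        ((eventually_all_finset X).2 fun x _ => (eventually_all_finset X).2 fun y _ =>
          eventually_nhdsGT_add_ne x y))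
  have hstruct : ∀ᶠ h in 𝓝[>] (0 : ℝ), #(Y h) = 2 * #X + 1 + 1 ∧ (∀ y ∈ Y h, y ∈ Set.Icc a b) ∧
      ∀ t, ∏ y ∈ Y h, (t - y) = (t - a) * ((t - b) * ∏ x ∈ X, ((t - x) * (t - (x + h)))) := by
    filter_upwards [hgood] with h ⟨h0, hlt, hne⟩
    have hdisj : Disjoint X (X.map (addRightEmbedding h)) := by
      rw [disjoint_left]
      simp only [Finset.mem_map, addRightEmbedding_apply, not_exists, not_and]
      exact fun z hz y hy => hne y hy z hz
    have hb : b ∉ X ∪ X.map (addRightEmbedding h) := by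
      simp only [mem_union, Finset.mem_map, addRightEmbedding_apply, not_or, not_exists, not_and]
      exact ⟨hbX, fun y hy => (hlt y hy).ne⟩
    have ha : a ∉ insert b (X ∪ X.map (addRightEmbedding h)) := by
      simp only [mem_insert, mem_union, Finset.mem_map, addRightEmbedding_apply, not_or, not_exists,
        not_and]
      exact ⟨hab.ne, haX, fun y hy => ((hX y hy).1.trans (lt_add_of_pos_right y h0)).ne'⟩
    refine ⟨?_, ?_, fun t => ?_⟩
    · simp only [Y]
      rw [card_insert_of_notMem ha, card_insert_of_notMem hb, card_union_of_disjoint hdisj,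
        card_map]
      ring
    · intro y hy
      simp only [Y, mem_insert, mem_union, Finset.mem_map, addRightEmbedding_apply] at hy
      rcases hy with rfl | rfl | hy | ⟨x, hx, rfl⟩
      · exact ⟨le_rfl, hab.le⟩
      · exact ⟨hab.le, le_rfl⟩
      · exact Set.Ioo_subset_Icc_self (hX y hy)
      · exact ⟨((hX x hx).1.trans (lt_add_of_pos_right x h0)).le, (hlt x hx).le⟩
    · simp only [Y]
      rw [prod_insert ha, prod_insert hb, prod_union hdisj, prod_map, ← prod_mul_distrib]
      rfl
  have habove : ∀ t ∈ Set.Icc a b, ∀ᶠ h in 𝓝[>] (0 : ℝ), f t ≤ (p h).eval t := by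
    intro t ht
    by_cases htn : t ∈ insert a (insert b X)
    · exact .of_forall fun h => (hnode h t htn).ge
    · simp only [mem_insert, not_or] at htn
      obtain ⟨hta, htb, htX⟩ := htn
      filter_upwards [hstruct, (eventually_all_finset X).2 fun x hx =>
        eventually_nhdsGT_mul_pos (t := t) (x := x) fun h => htX (h ▸ hx)] with h ⟨hc, hI, hp⟩ hs
      refine hf.le_eval_interpolate hc hI ht ?_
      rw [hp]
      exact mul_neg_of_pos_of_neg (sub_pos.2 (lt_of_le_of_ne ht.1 (Ne.symm hta)))
        (mul_neg_of_neg_of_pos (sub_neg.2 (lt_of_le_of_ne ht.2 htb)) (prod_pos hs))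
  let A := insert a X
  have hAlt : ∀ x ∈ A, x < b := by simpa [A, hab] using fun x hx => (hX x hx).2
  have hAle : ∀ x ∈ A, a ≤ x := by simpa [A] using fun x hx => (hX x hx).1.le
  have hbA : b ∉ A := fun h => (hAlt b h).false
  obtain ⟨δ, hδ, hδb, hδne, hδpos⟩ : ∃ δ : ℝ, 0 < δ ∧ (∀ y ∈ A, y + δ < b) ∧
      (∀ y ∈ A, ∀ z ∈ A, y + δ ≠ z) ∧
      ∀ x ∈ A, ∀ y ∈ A, y ≠ x → 0 < (x - y) * (x + δ - y) := by
    refine Eventually.exists (f := 𝓝[>] (0 : ℝ)) (.and self_mem_nhdsWithin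
      (((eventually_all_finset A).2 fun x hx => eventually_nhdsGT_add_lt (hAlt x hx)).and
        (((eventually_all_finset A).2 fun x _ => (eventually_all_finset A).2 fun y _ =>
          eventually_nhdsGT_add_ne x y).and
            ((eventually_all_finset A).2 fun x _ => (eventually_all_finset A).2 fun y _ => ?_))))
    rcases eq_or_ne y x with rfl | hyx
    · simp
    · filter_upwards [eventually_nhdsGT_mul_pos hyx] with h hh _
      linarith
  let Z := insert b (A ∪ A.map (addRightEmbedding δ))
  have hZcard : #Z - 1 = 2 * #X + 2 := by
    have hdisj : Disjoint A (A.map (addRightEmbedding δ)) := by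
      rw [disjoint_left]
      simp only [Finset.mem_map, addRightEmbedding_apply, not_exists, not_and]
      exact fun z hz y hy => hδne y hy z hz
    have hb : b ∉ A ∪ A.map (addRightEmbedding δ) := by
      simp only [mem_union, Finset.mem_map, addRightEmbedding_apply, not_or, not_exists, not_and]
      exact ⟨hbA, fun y hy => (hδb y hy).ne⟩
    simp only [Z]
    rw [card_insert_of_notMem hb, card_union_of_disjoint hdisj, card_map,
      card_insert_of_notMem haX]
    lia
  obtain ⟨q, hqdeg, hq⟩ := exists_tendsto_eval_of_eventually_div_le U p (Z := Z)
    (insert_nonempty _ _) (by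
      refine hU ?_
      filter_upwards [hstruct] with h hh
      have := Lagrange.degree_interpolate_lt (s := Y h) (v := id) f Function.injective_id.injOn
      rw [hZcard]
      rwa [hh.1] at this)
    (fun z => f z / ∏ w ∈ Z.erase z, (z - w)) (by
      intro z hz
      by_cases hzn : z ∈ insert a (insert b X)
      · exact .of_forall fun h => by rw [hnode h z hzn]
      · obtain ⟨x, hx, rfl⟩ : ∃ x ∈ A, x + δ = z := by
          simp only [Z, A, mem_insert, mem_union, Finset.mem_map, addRightEmbedding_apply] at hz hzn ⊢
          rcases hz with hz | hz | hz
          · simp [hz] at hzn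
          · tauto
          · exact hz
        have hneg := prod_erase_shift_neg hδ hx hδb hδne hbA (hδpos x hx)
        filter_upwards [hU (habove (x + δ) ⟨by linarith [hAle x hx], (hδb x hx).le⟩)] with h hh
        exact (div_le_div_right_of_neg hneg).2 hh)
  have hqnode : ∀ t ∈ insert a (insert b X), q.eval t = f t := fun t ht =>
    tendsto_nhds_unique (hq t) (by simp only [fun h => hnode h t ht, tendsto_const_nhds])
  refine ⟨q, hZcard ▸ hqdeg, hqnode a (by simp), hqnode b (by simp),
    fun x hx => hqnode x (by simp [hx]), fun t ht => ?_⟩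
  exact ge_of_tendsto (hq t) (hU (habove t ht))

end

/-- Support theorem (Lobatto type): a `(2n-1)`-convex function on `[a,b]` admits,
for nodes `x₀ = a`, `x_n = b` and `n-1` pairwise distinct interior nodes,
a polynomial of degree at most `2n-1` interpolating it at these `n+1` points
and supporting it from above on `[a,b]`. -/
theorem nconvex_support_above_endpoint_nodes
    (n : ℕ) (hn : 1 ≤ n) (a b : ℝ) (hab : a < b) (f : ℝ → ℝ)
    (hf : NConvexOn (2 * n - 1) (Set.Icc a b) f)
    (x : Fin (n + 1) → ℝ) (hxinj : Function.Injective x)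
    (hx0 : x 0 = a) (hxl : x (Fin.last n) = b)
    (hx : ∀ i, i ≠ 0 → i ≠ Fin.last n → x i ∈ Set.Ioo a b) :
    ∃ p : Polynomial ℝ, p.natDegree ≤ 2 * n - 1 ∧
      (∀ i, p.eval (x i) = f (x i)) ∧
      (∀ t ∈ Set.Icc a b, f t ≤ p.eval t) := by
  classical
  let X : Finset ℝ := ((Finset.univ.erase 0).erase (Fin.last n)).image x
  have h0l : Fin.last n ≠ 0 := fun h => hab.ne (by rw [← hx0, ← hxl, h])
  have hXcard : X.card = n - 1 := by
    rw [Finset.card_image_of_injective _ hxinj, Finset.card_erase_of_mem (by simp [h0l]),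
      Finset.card_erase_of_mem (Finset.mem_univ _), Finset.card_univ, Fintype.card_fin]
    lia
  obtain ⟨p, hpdeg, hpa, hpb, hpX, hp⟩ := NConvexOn.exists_support_above (X := X) hab
    (f := f) (by rw [hXcard]; convert hf using 1; lia) (by
      intro y hy
      obtain ⟨i, hi, rfl⟩ := Finset.mem_image.1 hy
      simp only [Finset.mem_erase] at hi
      exact hx i hi.2.1 hi.1)
  refine ⟨p, ?_, fun i => ?_, hp⟩
  · have : p.natDegree < 2 * X.card + 2 := by
      rcases eq_or_ne p 0 with rfl | hp0
      · simp
      · exact (Polynomial.natDegree_lt_iff_degree_lt hp0).2 hpdeg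
    lia
  · by_cases hi0 : i = 0
    · rw [hi0, hx0, hpa]
    by_cases hil : i = Fin.last n
    · rw [hil, hxl, hpb]
    exact hpX _ (Finset.mem_image_of_mem x (by simp [hi0, hil]))
end

section
/- Let n ∈ ℕ, n ≥ 1, let f : [a,b] → ℝ be 2n-convex, and let x_1 = a and x_2,…,x_{n+1} be pairwise distinct points of the open interval (a,b). Then there exists a polynomial p of degree at most 2n such that p(x_i) = f(x_i) for i = 1,…,n+1 and p(x) ≤ f(x) for all x ∈ [a,b]. -/
open Finset Filter Topology Polynomial

/-- The divided-difference inequality of an `m`-convex function, for nodes indexed by an arbitrary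
finite type with `m + 2` elements. -/
lemma NConvexOn.sum_div_prod_nonneg_s8 {ι : Type*} [Fintype ι] [DecidableEq ι] {m : ℕ} {s : Set ℝ}
    {f : ℝ → ℝ} (hf : NConvexOn m s f) (hcard : Fintype.card ι = m + 2) {z : ι → ℝ}
    (hz : Function.Injective z) (hzs : ∀ i, z i ∈ s) :
    0 ≤ ∑ i, f (z i) / ∏ j ∈ univ.erase i, (z i - z j) := by
  let e : Fin (m + 2) ≃ ι := (Fintype.equivFinOfCardEq hcard).symm
  refine (hf (z ∘ e) (hz.comp e.injective) fun i => hzs _).trans_eq ?_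
  refine Fintype.sum_equiv e _ _ fun i => ?_
  have : univ.erase (e i) = (univ.erase i).map e.toEmbedding := by
    rw [map_erase]; simp
  rw [this, prod_map]
  rfl

/-- The divided difference of a polynomial vanishes when its degree is too small. -/
lemma Polynomial.sum_eval_div_prod_eq_zero {ι : Type*} [Fintype ι] [DecidableEq ι] {z : ι → ℝ}
    (hz : Function.Injective z) {p : ℝ[X]} (hp : p.natDegree + 1 < Fintype.card ι) :
    ∑ i, p.eval (z i) / ∏ j ∈ univ.erase i, (z i - z j) = 0 := by
  have hdeg : p.degree < #(univ : Finset ι) :=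
    degree_le_natDegree.trans_lt (by rw [card_univ]; exact_mod_cast (by lia))
  rw [← Lagrange.coeff_eq_sum hz.injOn hdeg]
  exact coeff_eq_zero_of_natDegree_lt (by rw [card_univ]; lia)

/-- The error of polynomial interpolation of an `m`-convex function at `m + 1` nodes has the sign
of the nodal polynomial. -/
lemma NConvexOn.eval_le_of_prod_pos_s8 {κ : Type*} [Fintype κ] {m : ℕ} {s : Set ℝ}
    {f : ℝ → ℝ} (hf : NConvexOn m s f) (hcard : Fintype.card κ = m + 1) {z : κ → ℝ}
    (hz : Function.Injective z) (hzs : ∀ k, z k ∈ s) {p : ℝ[X]} (hp : p.natDegree ≤ m)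
    (hpz : ∀ k, p.eval (z k) = f (z k)) {t : ℝ} (hts : t ∈ s) (ht : 0 < ∏ k, (t - z k)) :
    p.eval t ≤ f t := by
  classical
  let w : Option κ → ℝ := fun o => o.elim t z
  have htz : ∀ k, t ≠ z k := fun k h =>
    ht.ne' (prod_eq_zero (mem_univ k) (sub_eq_zero.2 h))
  have hw : Function.Injective w := by
    rintro (_ | i) (_ | j) h
    · rfl
    · exact absurd h (htz j)
    · exact absurd h.symm (htz i)
    · exact congrArg some (hz h)
  have hc : Fintype.card (Option κ) = m + 2 := by rw [Fintype.card_option, hcard]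
  have h1 := hf.sum_div_prod_nonneg_s8 hc hw (by rintro (_ | k); exacts [hts, hzs k])
  have h2 := Polynomial.sum_eval_div_prod_eq_zero hw (p := p) (by lia)
  rw [Fintype.sum_option] at h1 h2
  have hprod : ∏ j ∈ univ.erase none, (w none - w j) = ∏ k, (t - z k) := by
    have : (univ : Finset (Option κ)).erase none = univ.map Function.Embedding.some := by
      ext (_ | k) <;> simp
    rw [this, prod_map]
    rfl
  have hsum : ∑ k, f (w (some k)) / ∏ j ∈ univ.erase (some k), (w (some k) - w j) =
      ∑ k, p.eval (w (some k)) / ∏ j ∈ univ.erase (some k), (w (some k) - w j) :=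
    sum_congr rfl fun k _ => by rw [show w (some k) = z k from rfl, hpz k]
  rw [hsum] at h1
  rw [hprod] at h1 h2
  exact (div_le_div_iff_of_pos_right ht).1 (show p.eval t / _ ≤ f t / _ by
    change 0 ≤ f t / _ + _ at h1
    change p.eval t / _ + _ = 0 at h2
    linarith)

/-- A family of polynomials of degree less than `d` that is bounded at `d` points has a cluster
point for pointwise convergence. -/
lemma Polynomial.exists_eval_mem_of_eventually_bounded {κ ι : Type*} [Fintype κ] {l : Filter ι}
    [l.NeBot] {v : κ → ℝ} (hv : Function.Injective v) {P : ι → ℝ[X]}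
    (hdeg : ∀ᶠ i in l, (P i).degree < Fintype.card κ) (A B : κ → ℝ)
    (hb : ∀ᶠ i in l, ∀ k, (P i).eval (v k) ∈ Set.Icc (A k) (B k)) :
    ∃ p : ℝ[X], p.degree < Fintype.card κ ∧ ∀ (t : ℝ) (s : Set ℝ), IsClosed s →
      (∀ᶠ i in l, (P i).eval t ∈ s) → p.eval t ∈ s := by
  classical
  let Y : ι → κ → ℝ := fun i k => (P i).eval (v k)
  have hK : IsCompact (Set.univ.pi fun k => Set.Icc (A k) (B k)) :=
    isCompact_univ_pi fun k => isCompact_Icc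
  obtain ⟨y, -, hy⟩ := hK.exists_mapClusterPt (f := l) (u := Y)
    (by
      rw [le_principal_iff, Filter.mem_map]
      filter_upwards [hb] with i hi k _ using hi k)
  refine ⟨Lagrange.interpolate univ v y, Lagrange.degree_interpolate_lt y hv.injOn,
    fun t s hs hts => ?_⟩
  have hcont : Continuous fun y : κ → ℝ => (Lagrange.interpolate univ v y).eval t := by
    simp only [Lagrange.interpolate_apply, eval_finsetSum, eval_mul, eval_C]
    fun_prop
  refine (hs.preimage hcont).mem_of_mapClusterPt hy ?_
  filter_upwards [hts, hdeg] with i hi hd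
  have := Lagrange.eq_interpolate (s := univ) hv.injOn hd
  change (Lagrange.interpolate univ v fun k => (P i).eval (v k)).eval t ∈ s
  rwa [← this]

/-- If all coefficients are positive, upper bounds on the variables and the value of a linear
combination give lower bounds on the variables. -/
lemma exists_forall_le_of_sum_mul_eq {ι : Type*} [Fintype ι] {c : ι → ℝ}
    (hc : ∀ i, 0 < c i) (B : ι → ℝ) (D : ℝ) :
    ∃ A : ι → ℝ, ∀ u : ι → ℝ, (∀ i, u i ≤ B i) → ∑ i, c i * u i = D → ∀ i, A i ≤ u i := by
  classical
  refine ⟨fun k => (D - ∑ i ∈ univ.erase k, c i * B i) / c k, fun u hu hD k => ?_⟩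
  rw [div_le_iff₀' (hc k), ← hD, ← add_sum_erase univ _ (mem_univ k)]
  have : ∑ i ∈ univ.erase k, c i * u i ≤ ∑ i ∈ univ.erase k, c i * B i :=
    sum_le_sum fun i _ => mul_le_mul_of_nonneg_left (hu i) (hc i).le
  linarith

/-- Distinct reals stay separated, and on the same side of each other, under small right shifts. -/
lemma eventually_forall_mul_add_pos {ι : Type*} [Finite ι] {x : ι → ℝ}
    (hx : Function.Injective x) :
    ∀ᶠ h in 𝓝[>] (0 : ℝ), ∀ i j, i ≠ j → 0 < (x i - x j) * (x i + h - x j) := by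
  refine eventually_all.2 fun i => eventually_all.2 fun j => ?_
  by_cases hij : i = j
  · simp [hij]
  have hc : ContinuousAt (fun h : ℝ => (x i - x j) * (x i + h - x j)) 0 := by fun_prop
  have hpos : 0 < (x i - x j) * (x i + 0 - x j) := by
    rw [add_zero]
    exact mul_self_pos.2 (sub_ne_zero.2 (hx.ne hij))
  filter_upwards [(hc.eventually_const_lt hpos).filter_mono nhdsWithin_le_nhds] with h hh _ using hh

/-- Nodes together with small right shifts of them are pairwise distinct. -/
lemma sumElim_add_injective {ι κ : Type*} {x : ι → ℝ} (hx : Function.Injective x) {g : κ → ι}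
    (hg : Function.Injective g) {h : ℝ} (h0 : 0 < h)
    (hh : ∀ i j, i ≠ j → 0 < (x i - x j) * (x i + h - x j)) :
    Function.Injective (Sum.elim x fun k => x (g k) + h) := by
  refine hx.sumElim (fun i j hij => hg (hx (add_right_cancel hij))) fun i k hik => ?_
  by_cases hki : g k = i
  · rw [hki] at hik; linarith
  · have := hh _ _ hki
    rw [← hik] at this
    simp at this

/-- The divided-difference weight at a shifted node is positive. -/
lemma prod_erase_inr_pos {ι : Type*} [Fintype ι] [DecidableEq ι] {x : ι → ℝ} {h : ℝ} (h0 : 0 < h)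
    (hh : ∀ i j, i ≠ j → 0 < (x i - x j) * (x i + h - x j)) (i : ι) :
    0 < ∏ j ∈ univ.erase (Sum.inr i : ι ⊕ ι), (x i + h - Sum.elim x (fun k => x k + h) j) := by
  have he : (univ : Finset (ι ⊕ ι)).erase (Sum.inr i) = univ.disjSum (univ.erase i) := by
    ext (j | j) <;> simp
  rw [he, prod_disjSum, ← mul_prod_erase univ _ (mem_univ i), mul_assoc, ← prod_mul_distrib]
  refine mul_pos (by simpa using h0) (prod_pos fun j hj => ?_)
  have := hh i j (ne_of_mem_erase hj).symm
  simp only [Sum.elim_inl, Sum.elim_inr]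
  nlinarith

/-- Support theorem (left Radau type): a `2n`-convex function on `[a,b]` admits,
for nodes `x₀ = a` and `n` pairwise distinct interior nodes, a polynomial of
degree at most `2n` interpolating it at these `n+1` points and supporting it
from below on `[a,b]`. -/
theorem nconvex_support_below_left_endpoint_nodes
    (n : ℕ) (hn : 1 ≤ n) (a b : ℝ) (hab : a < b) (f : ℝ → ℝ)
    (hf : NConvexOn (2 * n) (Set.Icc a b) f)
    (x : Fin (n + 1) → ℝ) (hxinj : Function.Injective x)
    (hx0 : x 0 = a)
    (hx : ∀ i, i ≠ 0 → x i ∈ Set.Ioo a b) :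
    ∃ p : Polynomial ℝ, p.natDegree ≤ 2 * n ∧
      (∀ i, p.eval (x i) = f (x i)) ∧
      (∀ t ∈ Set.Icc a b, p.eval t ≤ f t) := by
  have hxa : ∀ i, a ≤ x i := fun i => by
    by_cases hi : i = 0
    · rw [hi, hx0]
    · exact (hx i hi).1.le
  have hxb : ∀ i, x i < b := fun i => by
    by_cases hi : i = 0
    · rwa [hi, hx0]
    · exact (hx i hi).2
  have hsep := eventually_forall_mul_add_pos hxinj
  have hpos : ∀ᶠ h in 𝓝[>] (0 : ℝ), 0 < h := eventually_mem_nhdsWithin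
  have hmem : ∀ᶠ h in 𝓝[>] (0 : ℝ), ∀ i, x i + h ∈ Set.Icc a b := by
    refine eventually_all.2 fun i => ?_
    filter_upwards [hpos, nhdsWithin_le_nhds (Iio_mem_nhds (sub_pos.2 (hxb i)))] with h h0 h1
    have h1 : h < b - x i := h1
    exact ⟨by linarith [hxa i], by linarith⟩
  have hcard : Fintype.card (Fin (n + 1) ⊕ Fin n) = 2 * n + 1 := by
    simp only [Fintype.card_sum, Fintype.card_fin]; lia
  let z : ℝ → Fin (n + 1) ⊕ Fin n → ℝ := fun h => Sum.elim x fun i => x i.succ + h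
  let P : ℝ → ℝ[X] := fun h => Lagrange.interpolate univ (z h) fun k => f (z h k)
  have hzinj : ∀ᶠ h in 𝓝[>] (0 : ℝ), Function.Injective (z h) := by
    filter_upwards [hpos, hsep] with h h0 hh
    exact sumElim_add_injective hxinj (Fin.succ_injective n) h0 hh
  have hPdeg : ∀ᶠ h in 𝓝[>] (0 : ℝ), (P h).degree < Fintype.card (Fin (n + 1) ⊕ Fin n) := by
    filter_upwards [hzinj] with h hz using Lagrange.degree_interpolate_lt _ hz.injOn
  have hnat : ∀ p : ℝ[X], p.degree < Fintype.card (Fin (n + 1) ⊕ Fin n) →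
      p.natDegree ≤ 2 * n := fun p hp => by
    rw [hcard] at hp
    by_cases h0 : p = 0
    · simp [h0]
    · exact Nat.lt_succ_iff.1 ((natDegree_lt_iff_degree_lt h0).2 hp)
  have hPz : ∀ᶠ h in 𝓝[>] (0 : ℝ), ∀ k, (P h).eval (z h k) = f (z h k) := by
    filter_upwards [hzinj] with h hz k
    exact Lagrange.eval_interpolate_at_node _ hz.injOn (mem_univ k)
  have hPle : ∀ t ∈ Set.Icc a b, (∀ i, t ≠ x i) →
      ∀ᶠ h in 𝓝[>] (0 : ℝ), (P h).eval t ≤ f t := by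
    intro t ht htx
    have hside : ∀ᶠ h in 𝓝[>] (0 : ℝ), ∀ i : Fin n,
        0 < (t - x i.succ) * (t - (x i.succ + h)) := by
      refine eventually_all.2 fun i => ?_
      have hc : ContinuousAt (fun h : ℝ => (t - x i.succ) * (t - (x i.succ + h))) 0 := by
        fun_prop
      have h0 : 0 < (t - x i.succ) * (t - (x i.succ + 0)) := by
        rw [add_zero]
        exact mul_self_pos.2 (sub_ne_zero.2 (htx _))
      exact (hc.eventually_const_lt h0).filter_mono nhdsWithin_le_nhds
    filter_upwards [hzinj, hPdeg, hPz, hmem, hside] with h hz hd he hm hs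
    refine hf.eval_le_of_prod_pos_s8 hcard hz ?_ (hnat _ hd) he ht ?_
    · rintro (i | i)
      · exact ⟨hxa i, (hxb i).le⟩
      · exact hm i.succ
    · rw [Fintype.prod_sum_type, Fin.prod_univ_succ, mul_assoc, ← prod_mul_distrib]
      refine mul_pos ?_ (prod_pos fun i _ => hs i)
      change 0 < t - x 0
      rw [hx0]
      exact sub_pos.2 (lt_of_le_of_ne ht.1 fun h => htx 0 (by rw [hx0, h]))
  obtain ⟨δ, hδ, hδsep, hδmem⟩ := (hpos.and (hsep.and hmem)).exists
  let w : Fin (n + 1) ⊕ Fin (n + 1) → ℝ := Sum.elim x fun i => x i + δ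
  have hw : Function.Injective w :=
    sumElim_add_injective hxinj (g := id) Function.injective_id hδ hδsep
  let c : Fin (n + 1) → ℝ := fun i => (∏ j ∈ univ.erase (Sum.inr i), (x i + δ - w j))⁻¹
  have hc : ∀ i, 0 < c i := fun i => inv_pos.2 (prod_erase_inr_pos hδ hδsep i)
  obtain ⟨A, hA⟩ := exists_forall_le_of_sum_mul_eq hc (fun i => f (x i + δ))
    (-∑ i, f (x i) / ∏ j ∈ univ.erase (Sum.inl i), (x i - w j))
  have hupper : ∀ᶠ h in 𝓝[>] (0 : ℝ), ∀ i, (P h).eval (x i + δ) ≤ f (x i + δ) :=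
    eventually_all.2 fun i => hPle _ (hδmem i) fun j hj =>
      Sum.inr_ne_inl (hw (a₁ := Sum.inr i) (a₂ := Sum.inl j) hj)
  have hlower : ∀ᶠ h in 𝓝[>] (0 : ℝ), ∀ i, A i ≤ (P h).eval (x i + δ) := by
    filter_upwards [hupper, hPdeg, hPz] with h hu hd he
    refine hA _ hu ?_
    have hdd := Polynomial.sum_eval_div_prod_eq_zero hw (p := P h) (by
      have := hnat _ hd
      simp only [Fintype.card_sum, Fintype.card_fin]; lia)
    rw [Fintype.sum_sum_type] at hdd
    have hl : ∀ i, (P h).eval (w (Sum.inl i)) = f (x i) := fun i => he (Sum.inl i)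
    simp only [hl] at hdd
    rw [eq_neg_iff_add_eq_zero, add_comm, ← hdd]
    congr 1
    exact sum_congr rfl fun i _ => by rw [mul_comm, div_eq_mul_inv]; rfl
  obtain ⟨p, hpdeg, hp⟩ := Polynomial.exists_eval_mem_of_eventually_bounded (l := 𝓝[>] (0 : ℝ))
    (sumElim_add_injective hxinj (Fin.succ_injective n) hδ hδsep) hPdeg
    (Sum.elim (fun i => f (x i)) fun i => A i.succ)
    (Sum.elim (fun i => f (x i)) fun i => f (x i.succ + δ)) (by
      filter_upwards [hPz, hlower, hupper] with h he hl hu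
      rintro (i | i)
      · exact ⟨(he (Sum.inl i)).ge, (he (Sum.inl i)).le⟩
      · exact ⟨hl i.succ, hu i.succ⟩)
  have hpx : ∀ i, p.eval (x i) = f (x i) := fun i =>
    hp (x i) {f (x i)} isClosed_singleton (hPz.mono fun h he => he (Sum.inl i))
  refine ⟨p, hnat p hpdeg, hpx, fun t ht => ?_⟩
  by_cases htx : ∃ i, t = x i
  · obtain ⟨i, rfl⟩ := htx
    exact (hpx i).le
  · exact hp t (Set.Iic (f t)) isClosed_Iic (hPle t ht (not_exists.1 htx))
end

section
/- Fix n ∈ ℕ, n ≥ 1. Let x_1 = −1 and x_2,…,x_{n+1} be pairwise distinct points of (−1,1), with weights w_1,…,w_{n+1} ∈ ℝ such that Σ_{i=1}^{n+1} w_i p(x_i) = ∫_{−1}^{1} p(x)dx for every polynomial p of degree at most 2n (a left Radau-type rule), and let y_1,…,y_n be pairwise distinct points of (−1,1) and y_{n+1} = 1, with weights v_1,…,v_{n+1} ∈ ℝ such that Σ_{i=1}^{n+1} v_i p(y_i) = ∫_{−1}^{1} p(x)dx for every polynomial p of degree at most 2n (a right Radau-type rule). Let T be a positive linear functional, defined on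 a linear subspace of the space of functions [−1,1] → ℝ that contains all polynomials and all 2n-convex functions, which is exact on Π_{2n}. Then for every 2n-convex function f : [−1,1] → ℝ one has Σ_{i=1}^{n+1} w_i f(x_i) ≤ T(f) ≤ Σ_{i=1}^{n+1} v_i f(y_i). -/
open Lagrange Filter Topology

/-- The divided difference of `f` at the points of a finite set. -/
noncomputable def dividedDifference (f : ℝ → ℝ) (S : Finset ℝ) : ℝ :=
  ∑ i ∈ S, nodalWeight S id i * f i

lemma nodalWeight_id_insert_of_mem {S : Finset ℝ} {a i : ℝ} (ha : a ∉ S) (hi : i ∈ S) :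
    nodalWeight (insert a S) id i = (i - a)⁻¹ * nodalWeight S id i := by
  have hia : a ≠ i := fun h => ha (h ▸ hi)
  simp only [nodalWeight, id]
  rw [Finset.erase_insert_of_ne hia, Finset.prod_insert (by simp [ha])]

lemma nodalWeight_id_insert_self {S : Finset ℝ} {a : ℝ} (ha : a ∉ S) :
    nodalWeight (insert a S) id a = ∏ j ∈ S, (a - j)⁻¹ := by
  simp [nodalWeight, Finset.erase_insert ha]

lemma dividedDifference_insert (f : ℝ → ℝ) {S : Finset ℝ} {a : ℝ} (ha : a ∉ S) :
    dividedDifference f (insert a S) =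
      (∏ j ∈ S, (a - j)⁻¹) * f a + ∑ i ∈ S, (i - a)⁻¹ * nodalWeight S id i * f i := by
  rw [dividedDifference, Finset.sum_insert ha, nodalWeight_id_insert_self ha]
  congr 1
  exact Finset.sum_congr rfl fun i hi => by rw [nodalWeight_id_insert_of_mem ha hi]

lemma sub_mul_dividedDifference_insert_insert (f : ℝ → ℝ) {S : Finset ℝ} {a b : ℝ}
    (ha : a ∉ S) (hb : b ∉ S) (hab : a ≠ b) :
    (b - a) * dividedDifference f (insert a (insert b S)) =
      dividedDifference f (insert b S) - dividedDifference f (insert a S) := by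
  have hba : b - a ≠ 0 := sub_ne_zero.2 hab.symm
  have hab' : a - b ≠ 0 := sub_ne_zero.2 hab
  rw [dividedDifference_insert f (S := insert b S) (by simp [ha, hab]),
    Finset.prod_insert hb, Finset.sum_insert hb, nodalWeight_id_insert_self hb,
    dividedDifference_insert f ha, dividedDifference_insert f hb]
  have hsum : (b - a) * ∑ i ∈ S, (i - a)⁻¹ * nodalWeight (insert b S) id i * f i =
      ∑ i ∈ S, (i - b)⁻¹ * nodalWeight S id i * f i -
        ∑ i ∈ S, (i - a)⁻¹ * nodalWeight S id i * f i := by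
    rw [Finset.mul_sum, ← Finset.sum_sub_distrib]
    refine Finset.sum_congr rfl fun i hi => ?_
    have hia : i - a ≠ 0 := sub_ne_zero.2 fun h => ha (h ▸ hi)
    have hib : i - b ≠ 0 := sub_ne_zero.2 fun h => hb (h ▸ hi)
    rw [nodalWeight_id_insert_of_mem hb hi]
    field_simp
    ring
  rw [mul_add, mul_add, hsum]
  field_simp
  ring

/-- The Newton form of the interpolation error. -/
lemma sub_eval_interpolate (f : ℝ → ℝ) {S : Finset ℝ} {t : ℝ} (ht : t ∉ S) :
    f t - (interpolate S id f).eval t =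
      dividedDifference f (insert t S) * ∏ j ∈ S, (t - j) := by
  have hne : ∏ j ∈ S, (t - j) ≠ 0 :=
    Finset.prod_ne_zero_iff.2 fun j hj => sub_ne_zero.2 fun h => ht (h ▸ hj)
  rw [eval_interpolate_not_at_node f (fun i hi h => ht (by simpa [h] using hi)),
    dividedDifference_insert f ht, eval_nodal, Finset.prod_inv_distrib]
  have hsum : ∑ i ∈ S, (i - t)⁻¹ * nodalWeight S id i * f i =
      -∑ i ∈ S, nodalWeight S id i * (t - id i)⁻¹ * f i := by
    rw [← Finset.sum_neg_distrib]
    refine Finset.sum_congr rfl fun i _ => ?_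
    rw [id, ← neg_sub t i, inv_neg]
    ring
  rw [hsum]
  simp only [id]
  field_simp
  ring

lemma NConvexOn.dividedDifference_nonneg {n : ℕ} {s : Set ℝ} {f : ℝ → ℝ}
    (hf : NConvexOn n s f) {S : Finset ℝ} (hS : (S : Set ℝ) ⊆ s) (hcard : S.card = n + 2) :
    0 ≤ dividedDifference f S := by
  have hmap : Finset.univ.map (S.orderEmbOfFin hcard).toEmbedding = S := by
    simp
  have h := hf (S.orderEmbOfFin hcard) (S.orderEmbOfFin hcard).injective
    fun i => hS (S.orderEmbOfFin_mem hcard i)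
  refine h.trans_eq ?_
  conv_rhs => rw [dividedDifference, ← hmap, Finset.sum_map]
  refine Finset.sum_congr rfl fun i _ => ?_
  rw [nodalWeight, ← Finset.map_erase, Finset.prod_map, Finset.prod_inv_distrib, div_eq_inv_mul]
  rfl

lemma NConvexOn.dividedDifference_union_le {n : ℕ} {s : Set ℝ} {f : ℝ → ℝ}
    (hf : NConvexOn n s f) {A B R : Finset ℝ} (hA : (A : Set ℝ) ⊆ s) (hB : (B : Set ℝ) ⊆ s)
    (hR : (R : Set ℝ) ⊆ s) (hRA : Disjoint R A) (hRB : Disjoint R B)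
    (hAB : ∀ a ∈ A, ∀ b ∈ B, a < b) (hcard : A.card = B.card)
    (hcardR : R.card + A.card = n + 1) :
    dividedDifference f (R ∪ A) ≤ dividedDifference f (R ∪ B) := by
  induction A using Finset.induction_on generalizing B R with
  | empty =>
    have : B = ∅ := Finset.card_eq_zero.1 (by simpa using hcard.symm)
    simp [this]
  | insert a A ha ih =>
    rw [Finset.card_insert_of_notMem ha] at hcard hcardR
    obtain ⟨b, B, hb, rfl, hBcard⟩ := Finset.card_eq_succ.1 hcard.symm
    rw [Finset.disjoint_insert_right] at hRA hRB
    have hlt : a < b := hAB a (by simp) b (by simp)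
    have haB : a ∉ B := fun h => (hAB a (by simp) a (by simp [h])).false
    simp only [Finset.coe_insert, Set.insert_subset_iff] at hA hB
    have hle : dividedDifference f (insert a R ∪ A) ≤ dividedDifference f (insert a R ∪ B) := by
      refine ih hA.2 hB.2 ?_ ?_ ?_ ?_ hBcard.symm ?_
      · simpa [Set.insert_subset_iff] using ⟨hA.1, hR⟩
      · simpa using ⟨ha, hRA.2⟩
      · simpa using ⟨haB, hRB.2⟩
      · exact fun x hx y hy => hAB x (by simp [hx]) y (by simp [hy])
      · rw [Finset.card_insert_of_notMem hRA.1]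
        omega
    have haU : a ∉ R ∪ B := by simp [hRA.1, haB]
    have hbU : b ∉ R ∪ B := by simp [hRB.1, hb]
    have hnn : 0 ≤ dividedDifference f (insert a (insert b (R ∪ B))) := by
      refine hf.dividedDifference_nonneg ?_ ?_
      · simpa [Set.insert_subset_iff] using ⟨hA.1, hB.1, hR, hB.2⟩
      · rw [Finset.card_insert_of_notMem (by simp [hRA.1, haB, hlt.ne]),
          Finset.card_insert_of_notMem hbU, Finset.card_union_of_disjoint hRB.2]
        omega
    have hid := sub_mul_dividedDifference_insert_insert f haU hbU hlt.ne
    have := mul_nonneg (sub_pos.2 hlt).le hnn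
    rw [Finset.insert_union, Finset.insert_union] at hle
    rw [Finset.union_insert, Finset.union_insert]
    linarith

lemma exists_abs_dividedDifference_insert_le {n : ℕ} {f : ℝ → ℝ} {e a b : ℝ}
    (hf : NConvexOn n (Set.Icc (-1 : ℝ) 1) f) (he : e = -1 ∨ e = 1)
    (ha : -1 < a) (hab : a ≤ b) (hb : b < 1) :
    ∃ C : ℝ, ∀ S : Finset ℝ, (S : Set ℝ) ⊆ Set.Icc a b → S.card = n →
      |dividedDifference f (insert e S)| ≤ C := by
  obtain ⟨Z, hZ, hZc⟩ := (Set.Ioo_infinite ha).exists_subset_card_eq n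
  obtain ⟨W, hW, hWc⟩ := (Set.Ioo_infinite hb).exists_subset_card_eq n
  have heI : e ∈ Set.Icc (-1 : ℝ) 1 := by rcases he with rfl | rfl <;> simp
  have hdisj : ∀ {A : Finset ℝ}, (A : Set ℝ) ⊆ Set.Ioo (-1 : ℝ) 1 → Disjoint {e} A := by
    intro A hA
    rw [Finset.disjoint_singleton_left]
    intro h
    have := hA h
    rcases he with rfl | rfl <;> simp at this
  have hZ' : (Z : Set ℝ) ⊆ Set.Ioo (-1 : ℝ) 1 :=
    hZ.trans (Set.Ioo_subset_Ioo_right (hab.trans hb.le))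
  have hW' : (W : Set ℝ) ⊆ Set.Ioo (-1 : ℝ) 1 :=
    hW.trans (Set.Ioo_subset_Ioo_left (ha.le.trans hab))
  refine ⟨max |dividedDifference f (insert e Z)| |dividedDifference f (insert e W)|,
    fun S hS hSc => ?_⟩
  have hS' : (S : Set ℝ) ⊆ Set.Ioo (-1 : ℝ) 1 := hS.trans (Set.Icc_subset_Ioo ha hb)
  have h1 := hf.dividedDifference_union_le (R := {e}) (hZ'.trans Set.Ioo_subset_Icc_self)
    (hS'.trans Set.Ioo_subset_Icc_self) (by simpa using heI) (hdisj hZ') (hdisj hS')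
    (fun x hx y hy => (hZ hx).2.trans_le (hS hy).1) (by omega) (by simp; omega)
  have h2 := hf.dividedDifference_union_le (R := {e}) (hS'.trans Set.Ioo_subset_Icc_self)
    (hW'.trans Set.Ioo_subset_Icc_self) (by simpa using heI) (hdisj hS') (hdisj hW')
    (fun x hx y hy => (hS hx).2.trans_lt (hW hy).1) (by omega) (by simp; omega)
  simp only [← Finset.insert_eq] at h1 h2
  exact abs_le_max_abs_abs h1 h2

/-- For small shifts `h`, interpolation at an endpoint `e` and at the points of `U` and `U + h`
approximates a `2n`-convex function from one side up to an error of order `h`. -/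
lemma exists_polynomial_interpolating_one_sided {n : ℕ} {f : ℝ → ℝ} {e : ℝ}
    (hf : NConvexOn (2 * n) (Set.Icc (-1 : ℝ) 1) f) (he : e = -1 ∨ e = 1)
    {U : Finset ℝ} (hU : (U : Set ℝ) ⊆ Set.Ioo (-1 : ℝ) 1) (hUc : U.card = n)
    {ε : ℝ} (hε : 0 < ε) :
    ∃ p : Polynomial ℝ, p.natDegree ≤ 2 * n ∧ (∀ u ∈ insert e U, p.eval u = f u) ∧
      ∀ t ∈ Set.Icc (-1 : ℝ) 1, -ε ≤ -e * (f t - p.eval t) := by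
  obtain ⟨a, ha, ha1, hUa⟩ : ∃ a : ℝ, -1 < a ∧ a < 1 ∧ ∀ u ∈ U, a < u := by
    have : ∀ᶠ a in 𝓝[>] (-1 : ℝ), ∀ u ∈ U, a < u := by
      rw [Filter.eventually_all_finset]
      exact fun u hu => nhdsWithin_le_nhds (Iio_mem_nhds (hU hu).1)
    have hlt : ∀ᶠ a in 𝓝[>] (-1 : ℝ), a < 1 := nhdsWithin_le_nhds (Iio_mem_nhds (by norm_num))
    obtain ⟨a, ⟨h1, h2⟩, h3⟩ := ((this.and hlt).and self_mem_nhdsWithin).exists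
    exact ⟨a, h3, h2, h1⟩
  obtain ⟨b, hb, hUb⟩ : ∃ b : ℝ, b < 1 ∧ ∀ u ∈ insert a U, u < b := by
    have : ∀ᶠ b in 𝓝[<] (1 : ℝ), ∀ u ∈ insert a U, u < b := by
      rw [Filter.eventually_all_finset]
      refine fun u hu => nhdsWithin_le_nhds (Ioi_mem_nhds ?_)
      rcases Finset.mem_insert.1 hu with rfl | hu
      · exact ha1
      · exact (hU hu).2
    obtain ⟨b, h1, h2⟩ := (this.and self_mem_nhdsWithin).exists
    exact ⟨b, h2, h1⟩
  have hab : a ≤ b := (hUb a (by simp)).le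
  obtain ⟨C, hC⟩ := exists_abs_dividedDifference_insert_le hf he ha hab hb
  have hev : ∀ᶠ h in 𝓝[>] (0 : ℝ), (∀ u ∈ U, u + h < b) ∧
      (∀ u ∈ U, ∀ v ∈ U, u + h ≠ v) ∧ 4 * 4 ^ n * C * h < ε := by
    refine Filter.Eventually.and ?_ (Filter.Eventually.and ?_ ?_)
    · rw [Filter.eventually_all_finset]
      intro u hu
      have ht : Tendsto (fun h : ℝ => u + h) (𝓝 0) (𝓝 (u + 0)) :=
        (continuous_const.add continuous_id).tendsto 0
      exact nhdsWithin_le_nhds (ht.eventually_lt_const (by simpa using hUb u (by simp [hu])))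
    · simp only [Filter.eventually_all_finset]
      intro u _ v _
      rcases eq_or_ne u v with rfl | huv
      · filter_upwards [self_mem_nhdsWithin] with h hh
        simpa using (ne_of_gt hh)
      · filter_upwards [nhdsWithin_le_nhds (eventually_ne_nhds (sub_ne_zero.2 huv.symm).symm)]
          with h hh heq
        exact hh (by linarith)
    · have ht : Tendsto (fun h : ℝ => 4 * 4 ^ n * C * h) (𝓝 0) (𝓝 (4 * 4 ^ n * C * 0)) :=
        (continuous_const.mul continuous_id).tendsto 0
      exact nhdsWithin_le_nhds (ht.eventually_lt_const (by simpa using hε))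
  obtain ⟨h, ⟨hhb, hhne, hhε⟩, hh⟩ := (hev.and self_mem_nhdsWithin).exists
  replace hh : 0 < h := hh
  set V := U.image (· + h) with hV
  have hVc : V.card = n := by
    rw [hV, Finset.card_image_of_injective _ (add_left_injective h), hUc]
  have hUV : Disjoint U V := by
    rw [Finset.disjoint_left]
    intro v hv hv'
    obtain ⟨u, hu, huv⟩ := Finset.mem_image.1 hv'
    exact hhne u hu v hv huv
  have hUVc : (U ∪ V).card = 2 * n := by
    rw [Finset.card_union_of_disjoint hUV]
    omega
  have hUVab : ((U ∪ V : Finset ℝ) : Set ℝ) ⊆ Set.Icc a b := by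
    intro x hx
    rcases Finset.mem_union.1 (Finset.mem_coe.1 hx) with hx | hx
    · exact ⟨(hUa x hx).le, (hUb x (by simp [hx])).le⟩
    · obtain ⟨u, hu, rfl⟩ := Finset.mem_image.1 hx
      exact ⟨by linarith [hUa u hu], (hhb u hu).le⟩
  have heab : e ∉ Set.Icc a b := by
    rintro ⟨h1, h2⟩
    rcases he with rfl | rfl <;> linarith
  have heUV : e ∉ U ∪ V := fun h => heab (hUVab h)
  set S := insert e (U ∪ V) with hS
  have hinj : Set.InjOn (id : ℝ → ℝ) S := Function.injective_id.injOn
  have hSc : S.card = 2 * n + 1 := by rw [hS, Finset.card_insert_of_notMem heUV, hUVc]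
  have heval : ∀ u ∈ S, (interpolate S id f).eval u = f u :=
    fun u hu => eval_interpolate_at_node f hinj hu
  refine ⟨interpolate S id f, ?_, fun u hu => heval u ?_, fun t ht => ?_⟩
  · have := degree_interpolate_le f hinj
    rw [hSc] at this
    exact Polynomial.natDegree_le_of_degree_le this
  · rcases Finset.mem_insert.1 hu with rfl | hu <;> simp [*]
  by_cases htS : t ∈ S
  · rw [heval t htS, sub_self, mul_zero]
    linarith
  have hprod : ∏ j ∈ S, (t - j) = (t - e) * ∏ u ∈ U, ((t - u) * (t - (u + h))) := by
    rw [hS, Finset.prod_insert heUV, Finset.prod_union hUV, hV,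
      Finset.prod_image (add_left_injective h).injOn, Finset.prod_mul_distrib]
  rw [sub_eval_interpolate f htS, hprod]
  have heI : e ∈ Set.Icc (-1 : ℝ) 1 := by rcases he with rfl | rfl <;> simp
  have hte : 0 ≤ -e * (t - e) ∧ -e * (t - e) ≤ 2 := by
    rcases he with rfl | rfl <;> constructor <;> linarith [ht.1, ht.2]
  have hSI : (S : Set ℝ) ⊆ Set.Icc (-1 : ℝ) 1 := by
    rw [hS, Finset.coe_insert, Set.insert_subset_iff]
    exact ⟨heI, hUVab.trans (Set.Icc_subset_Icc ha.le hb.le)⟩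
  have hD : 0 ≤ dividedDifference f (insert t S) := by
    refine hf.dividedDifference_nonneg ?_ (by rw [Finset.card_insert_of_notMem htS, hSc])
    rw [Finset.coe_insert, Set.insert_subset_iff]
    exact ⟨ht, hSI⟩
  by_cases hgood : ∀ u ∈ U, 0 ≤ (t - u) * (t - (u + h))
  · have := mul_nonneg hte.1 (mul_nonneg hD (Finset.prod_nonneg hgood))
    linarith
  push Not at hgood
  obtain ⟨u, hu, hneg⟩ := hgood
  have htu : u < t ∧ t < u + h := by
    constructor <;> by_contra! hle <;> nlinarith
  -- the divided difference is at most `2 * C / h` in this case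
  have hDle : h * dividedDifference f (insert t S) ≤ 2 * C := by
    set R := insert t (((U ∪ V).erase u).erase (u + h)) with hR
    have huV : u + h ∈ V := Finset.mem_image_of_mem _ hu
    have huh : u + h ≠ u := by linarith
    have htUV : t ∉ U ∪ V := fun h => htS (Finset.mem_insert_of_mem h)
    have hmem : u + h ∈ (U ∪ V).erase u := by simp [huV, hh.ne']
    have hRab : (R : Set ℝ) ⊆ Set.Icc a b := by
      rw [hR, Finset.coe_insert, Set.insert_subset_iff]
      refine ⟨⟨(hUa u hu).le.trans htu.1.le, htu.2.le.trans (hhb u hu).le⟩, ?_⟩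
      exact ((Finset.coe_subset.2
        ((Finset.erase_subset _ _).trans (Finset.erase_subset _ _)))).trans hUVab
    have hRc : R.card + 1 = 2 * n := by
      have h1 := Finset.card_erase_add_one hmem
      have h2 := Finset.card_erase_add_one (Finset.mem_union_left V hu)
      rw [hR, Finset.card_insert_of_notMem (by simp [htUV] )]
      omega
    have huR : u ∉ R := by simp [hR, htu.1.ne]
    have huhR : u + h ∉ R := by simp [hR, htu.2.ne']
    have heu : e ≠ u := fun h => heUV (h ▸ Finset.mem_union_left V hu)
    have heuh : e ≠ u + h := fun h => heUV (h ▸ Finset.mem_union_right U huV)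
    have hset : insert t S = insert u (insert (u + h) (insert e R)) := by
      rw [hR, Finset.insert_comm e t, Finset.insert_comm (u + h) t, Finset.insert_comm u t,
        Finset.insert_comm (u + h) e, Finset.insert_erase hmem, Finset.insert_comm u e,
        Finset.insert_erase (Finset.mem_union_left V hu)]
    have hbound : ∀ x ∈ Set.Icc a b, x ∉ R → |dividedDifference f (insert x (insert e R))| ≤ C := by
      intro x hx hxR
      rw [Finset.insert_comm]
      refine hC _ ?_ (by rw [Finset.card_insert_of_notMem hxR, hRc])
      rw [Finset.coe_insert, Set.insert_subset_iff]
      exact ⟨hx, hRab⟩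
    have hid := sub_mul_dividedDifference_insert_insert f (S := insert e R) (a := u) (b := u + h)
      (by simp [heu.symm, huR]) (by simp [heuh.symm, huhR]) huh.symm
    rw [← hset, add_sub_cancel_left] at hid
    have h1 := abs_le.1 (hbound u (hUVab (Finset.mem_union_left V hu)) huR)
    have h2 := abs_le.1 (hbound (u + h) (hUVab (Finset.mem_union_right U huV)) huhR)
    linarith [h1.1, h2.2]
  have hPle : |∏ u ∈ U, ((t - u) * (t - (u + h)))| ≤ h ^ 2 * 4 ^ n := by
    rw [Finset.abs_prod, ← Finset.mul_prod_erase U _ hu]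
    refine mul_le_mul ?_ ?_ (Finset.prod_nonneg fun _ _ => abs_nonneg _) (sq_nonneg h)
    · rw [abs_mul, abs_of_pos (sub_pos.2 htu.1), abs_of_neg (sub_neg.2 htu.2), sq]
      exact mul_le_mul (by linarith) (by linarith) (by linarith) hh.le
    · have hle : ∏ x ∈ U.erase u, |(t - x) * (t - (x + h))| ≤ ∏ _x ∈ U.erase u, (4 : ℝ) := by
        refine Finset.prod_le_prod (fun _ _ => abs_nonneg _) fun x hx => ?_
        have hxU := Finset.mem_of_mem_erase hx
        have h1 := hUa x hxU
        have h2 := hhb x hxU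
        rw [abs_mul, show (4 : ℝ) = 2 * 2 by norm_num]
        exact mul_le_mul (abs_le.2 ⟨by linarith [ht.1, ht.2], by linarith [ht.1, ht.2]⟩)
          (abs_le.2 ⟨by linarith [ht.1, ht.2], by linarith [ht.1, ht.2]⟩)
          (abs_nonneg _) (by norm_num)
      refine hle.trans ?_
      rw [Finset.prod_const]
      exact pow_le_pow_right₀ (by norm_num) (hUc ▸ Finset.card_erase_le)
  generalize dividedDifference f (insert t S) = D at *
  generalize ∏ u ∈ U, ((t - u) * (t - (u + h))) = P at *
  have hDP : D * |P| ≤ 2 * C * (h * 4 ^ n) := by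
    calc D * |P| ≤ D * (h ^ 2 * 4 ^ n) := mul_le_mul_of_nonneg_left hPle hD
      _ = h * D * (h * 4 ^ n) := by ring
      _ ≤ 2 * C * (h * 4 ^ n) := mul_le_mul_of_nonneg_right hDle (by positivity)
  have hDP0 : 0 ≤ D * |P| := mul_nonneg hD (abs_nonneg P)
  have hlow : -(D * |P|) ≤ D * P := by
    rw [← mul_neg]
    exact mul_le_mul_of_nonneg_left (neg_abs_le P) hD
  have h1 : -e * (t - e) * -(D * |P|) ≤ -e * (t - e) * (D * P) :=
    mul_le_mul_of_nonneg_left hlow hte.1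
  have h2 : -e * (t - e) * (D * |P|) ≤ 2 * (D * |P|) := mul_le_mul_of_nonneg_right hte.2 hDP0
  linarith

/-- A rule exact on `Π_{2n}` whose nodes are an endpoint `e` and `n` interior points bounds a
positive functional from the side determined by `e`. -/
lemma le_mul_positive_functional_sub_rule {n : ℕ} {e : ℝ} (he : e = -1 ∨ e = 1)
    (x : Fin (n + 1) → ℝ) (hxinj : Function.Injective x) (k : Fin (n + 1)) (hxk : x k = e)
    (hx : ∀ i, i ≠ k → x i ∈ Set.Ioo (-1 : ℝ) 1) (w : Fin (n + 1) → ℝ)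
    (hR : ∀ p : Polynomial ℝ, p.natDegree ≤ 2 * n →
      ∑ i, w i * p.eval (x i) = ∫ t in (-1 : ℝ)..1, p.eval t)
    (E : Submodule ℝ (ℝ → ℝ)) (T : E →ₗ[ℝ] ℝ)
    (hEpoly : ∀ p : Polynomial ℝ, (fun t : ℝ => p.eval t) ∈ E)
    (hTpos : ∀ g h : E, (∀ t ∈ Set.Icc (-1 : ℝ) 1, (g : ℝ → ℝ) t ≤ (h : ℝ → ℝ) t) →
      T g ≤ T h)
    (hTexact : ∀ p : Polynomial ℝ, p.natDegree ≤ 2 * n →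
      T ⟨fun t : ℝ => p.eval t, hEpoly p⟩ = ∫ t in (-1 : ℝ)..1, p.eval t)
    (f : ℝ → ℝ) (hf : NConvexOn (2 * n) (Set.Icc (-1 : ℝ) 1) f) (hfE : f ∈ E) :
    0 ≤ -e * (T ⟨f, hfE⟩ - ∑ i, w i * f (x i)) := by
  refine le_of_forall_pos_le_add fun ε hε => ?_
  have hU : (((Finset.univ.erase k).image x : Finset ℝ) : Set ℝ) ⊆ Set.Ioo (-1 : ℝ) 1 := by
    intro u hu
    obtain ⟨i, hi, rfl⟩ := Finset.mem_image.1 (Finset.mem_coe.1 hu)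
    exact hx i (Finset.ne_of_mem_erase hi)
  obtain ⟨p, hpdeg, hpe, hple⟩ := exists_polynomial_interpolating_one_sided hf he hU
    (by simp [Finset.card_image_of_injective _ hxinj]) (half_pos hε)
  have hpx : ∀ i, p.eval (x i) = f (x i) := by
    intro i
    refine hpe _ ?_
    by_cases hi : i = k
    · simp [hi, hxk]
    · exact Finset.mem_insert_of_mem (Finset.mem_image_of_mem x (by simp [hi]))
  have hTp : T ⟨fun t : ℝ => p.eval t, hEpoly p⟩ = ∑ i, w i * f (x i) := by
    rw [hTexact p hpdeg, ← hR p hpdeg]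
    simp only [hpx]
  have hT1 : T ⟨fun t : ℝ => (Polynomial.C (-(ε / 2))).eval t, hEpoly _⟩ = -ε := by
    rw [hTexact _ (by simp)]
    simp
    ring
  have hmono := hTpos ⟨fun t : ℝ => (Polynomial.C (-(ε / 2))).eval t, hEpoly _⟩
    (-e • (⟨f, hfE⟩ - ⟨fun t : ℝ => p.eval t, hEpoly p⟩)) fun t ht => by
      simpa using hple t ht
  rw [hT1, map_smul, map_sub, hTp, smul_eq_mul] at hmono
  linarith

/-- Theorem (Radau extremality): if `T` is a positive linear functional, defined
on a subspace of functions `[-1,1] → ℝ` containing all polynomials and all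
`2n`-convex functions, which is exact on `Π_{2n}`, then for every `2n`-convex
`f` one has `Rad^l_{n+1}(f) ≤ T(f) ≤ Rad^r_{n+1}(f)` for any left and right
Radau-type rules exact on `Π_{2n}`. -/
theorem radau_left_le_positive_functional_le_radau_right
    (n : ℕ) (hn : 1 ≤ n)
    (x : Fin (n + 1) → ℝ) (hxinj : Function.Injective x)
    (hx0 : x 0 = -1) (hx : ∀ i, i ≠ 0 → x i ∈ Set.Ioo (-1 : ℝ) 1)
    (w : Fin (n + 1) → ℝ)
    (hRl : ∀ p : Polynomial ℝ, p.natDegree ≤ 2 * n →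
      ∑ i, w i * p.eval (x i) = ∫ t in (-1 : ℝ)..1, p.eval t)
    (y : Fin (n + 1) → ℝ) (hyinj : Function.Injective y)
    (hyl : y (Fin.last n) = 1)
    (hy : ∀ i, i ≠ Fin.last n → y i ∈ Set.Ioo (-1 : ℝ) 1)
    (v : Fin (n + 1) → ℝ)
    (hRr : ∀ p : Polynomial ℝ, p.natDegree ≤ 2 * n →
      ∑ i, v i * p.eval (y i) = ∫ t in (-1 : ℝ)..1, p.eval t)
    (E : Submodule ℝ (ℝ → ℝ)) (T : E →ₗ[ℝ] ℝ)
    (hEpoly : ∀ p : Polynomial ℝ, (fun t : ℝ => p.eval t) ∈ E)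
    (hEconv : ∀ g : ℝ → ℝ, NConvexOn (2 * n) (Set.Icc (-1 : ℝ) 1) g → g ∈ E)
    (hTpos : ∀ g h : E, (∀ t ∈ Set.Icc (-1 : ℝ) 1, (g : ℝ → ℝ) t ≤ (h : ℝ → ℝ) t) →
      T g ≤ T h)
    (hTexact : ∀ p : Polynomial ℝ, p.natDegree ≤ 2 * n →
      T ⟨fun t : ℝ => p.eval t, hEpoly p⟩ = ∫ t in (-1 : ℝ)..1, p.eval t)
    (f : ℝ → ℝ) (hf : NConvexOn (2 * n) (Set.Icc (-1 : ℝ) 1) f) :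
    ∑ i, w i * f (x i) ≤ T ⟨f, hEconv f hf⟩ ∧
      T ⟨f, hEconv f hf⟩ ≤ ∑ i, v i * f (y i) := by
  constructor
  · have := le_mul_positive_functional_sub_rule (Or.inl rfl) x hxinj 0 hx0 hx w hRl E T hEpoly
      hTpos hTexact f hf (hEconv f hf)
    linarith
  · have := le_mul_positive_functional_sub_rule (Or.inr rfl) y hyinj (Fin.last n) hyl hy v hRr E T
      hEpoly hTpos hTexact f hf (hEconv f hf)
    linarith
end
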